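/- arXiv:2601.21588 — 5 statements merged into one kernel-verified Lean document; each statement's English description precedes it below -/
import Mathlib

section
/- Let f : ℍ → ℂ be a function on the upper half-plane, identified with a function of the two real variables (x,y) with y > 0, which is real analytic on ℍ and satisfies Δf = λ·f for some λ ∈ ℂ, where Δ = −y²(∂²/∂x² + ∂²/∂y²). If f(iy) = 0 and (∂f/∂x)(iy) = 0 for all y > 0, then f is identically zero on ℍ. -/
open Complex

/-- The directional derivative of a function on the plane along a fixed vector. -/
noncomputable def dirDeriv (v : ℝ × ℝ) (u : ℝ × ℝ → ℂ) : ℝ × ℝ → ℂ :=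
  fun p => fderiv ℝ u p v

/-- The open upper half-plane in real coordinates. -/
def upperHalf : Set (ℝ × ℝ) := {p | 0 < p.2}

theorem isOpen_upperHalf : IsOpen upperHalf :=
  isOpen_lt continuous_const continuous_snd

protected theorem AnalyticOnNhd.dirDeriv {u : ℝ × ℝ → ℂ} {s : Set (ℝ × ℝ)} (hu : AnalyticOnNhd ℝ u s)
    (v : ℝ × ℝ) : AnalyticOnNhd ℝ (dirDeriv v u) s := by
  intro p hp
  exact ((ContinuousLinearMap.apply ℝ ℂ v).analyticAt _).comp (hu p hp).fderiv

theorem AnalyticAt.dirDeriv_comm {u : ℝ × ℝ → ℂ} {p : ℝ × ℝ} (hu : AnalyticAt ℝ u p)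
    (v w : ℝ × ℝ) : dirDeriv v (dirDeriv w u) p = dirDeriv w (dirDeriv v u) p := by
  have hsymm : IsSymmSndFDerivAt ℝ u p :=
    (hu.contDiffAt (n := 2)).isSymmSndFDerivAt (by simp)
  have hd : DifferentiableAt ℝ (fderiv ℝ u) p := hu.fderiv.differentiableAt
  have key : ∀ a b : ℝ × ℝ, dirDeriv a (dirDeriv b u) p = fderiv ℝ (fderiv ℝ u) p a b := by
    intro a b
    change fderiv ℝ (fun q => fderiv ℝ u q b) p a = _
    rw [fderiv_clm_apply hd (differentiableAt_const b)]
    simp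
  rw [key, key]
  exact hsymm.eq v w

theorem dirDeriv_congr_of_eqOn {u v : ℝ × ℝ → ℂ} {s : Set (ℝ × ℝ)} (hs : IsOpen s)
    (h : Set.EqOn u v s) (w : ℝ × ℝ) : Set.EqOn (dirDeriv w u) (dirDeriv w v) s := by
  intro p hp
  have : u =ᶠ[nhds p] v := Filter.eventuallyEq_of_mem (hs.mem_nhds hp) h
  simp only [dirDeriv, this.fderiv_eq]

theorem AnalyticAt.hasDerivAt_fst {u : ℝ × ℝ → ℂ} {x y : ℝ} (hu : AnalyticAt ℝ u (x, y)) :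
    HasDerivAt (fun t : ℝ => u (t, y)) (dirDeriv (1, 0) u (x, y)) x :=
  hu.differentiableAt.hasFDerivAt.comp_hasDerivAt x
    ((hasDerivAt_id x).prodMk (hasDerivAt_const x y))

theorem AnalyticAt.hasDerivAt_snd {u : ℝ × ℝ → ℂ} {x y : ℝ} (hu : AnalyticAt ℝ u (x, y)) :
    HasDerivAt (fun t : ℝ => u (x, t)) (dirDeriv (0, 1) u (x, y)) y :=
  hu.differentiableAt.hasFDerivAt.comp_hasDerivAt y
    ((hasDerivAt_const y x).prodMk (hasDerivAt_id y))

/-- `u` is real analytic on the upper half-plane and an eigenfunction of the hyperbolic Laplacian,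
expressed through directional derivatives. -/
structure IsAnalyticEigenfunction (lam : ℂ) (u : ℝ × ℝ → ℂ) : Prop where
  analytic : AnalyticOnNhd ℝ u upperHalf
  eigen : ∀ x y : ℝ, 0 < y →
    -(y : ℂ) ^ 2 * (dirDeriv (1, 0) (dirDeriv (1, 0) u) (x, y)
      + dirDeriv (0, 1) (dirDeriv (0, 1) u) (x, y)) = lam * u (x, y)

namespace IsAnalyticEigenfunction

variable {lam : ℂ} {u : ℝ × ℝ → ℂ}

/-- Horizontal translations commute with the Laplacian, hence so does `∂/∂x`. -/
theorem dirDeriv_fst (hu : IsAnalyticEigenfunction lam u) :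
    IsAnalyticEigenfunction lam (dirDeriv (1, 0) u) := by
  refine ⟨hu.analytic.dirDeriv _, fun x y hy => ?_⟩
  have hp : (x, y) ∈ upperHalf := hy
  have hx := ((hu.analytic.dirDeriv (1, 0)).dirDeriv (1, 0) _ hp).hasDerivAt_fst
  have hy2 := ((hu.analytic.dirDeriv (0, 1)).dirDeriv (0, 1) _ hp).hasDerivAt_fst
  have hL := (hx.add hy2).const_mul (-(y : ℂ) ^ 2)
  have hR := ((hu.analytic _ hp).hasDerivAt_fst).const_mul lam
  have heq : (fun t : ℝ => lam * u (t, y)) = fun t : ℝ =>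
      -(y : ℂ) ^ 2 * (dirDeriv (1, 0) (dirDeriv (1, 0) u) (t, y)
        + dirDeriv (0, 1) (dirDeriv (0, 1) u) (t, y)) :=
    funext fun t => (hu.eigen t y hy).symm
  rw [heq] at hR
  have hcomm : dirDeriv (1, 0) (dirDeriv (0, 1) (dirDeriv (0, 1) u)) (x, y)
      = dirDeriv (0, 1) (dirDeriv (0, 1) (dirDeriv (1, 0) u)) (x, y) := by
    rw [(hu.analytic.dirDeriv (0, 1) _ hp).dirDeriv_comm]
    exact dirDeriv_congr_of_eqOn isOpen_upperHalf
      (fun q hq => (hu.analytic q hq).dirDeriv_comm _ _) _ hp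
  rw [← hcomm]
  exact hL.unique hR

theorem dirDeriv_fst_fst_eq_zero (hu : IsAnalyticEigenfunction lam u)
    (h0 : ∀ y : ℝ, 0 < y → u (0, y) = 0) (y : ℝ) (hy : 0 < y) :
    dirDeriv (1, 0) (dirDeriv (1, 0) u) (0, y) = 0 := by
  have hvanish : ∀ v : ℝ × ℝ → ℂ, AnalyticOnNhd ℝ v upperHalf →
      (∀ t : ℝ, 0 < t → v (0, t) = 0) → ∀ t : ℝ, 0 < t → dirDeriv (0, 1) v (0, t) = 0 := by
    intro v hv hv0 t ht
    have hev : (fun s : ℝ => v (0, s)) =ᶠ[nhds t] fun _ => 0 :=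
      Filter.eventuallyEq_of_mem (Ioi_mem_nhds ht) hv0
    exact (hv (0, t) ht).hasDerivAt_snd.unique ((hasDerivAt_const t 0).congr_of_eventuallyEq hev)
  have hyy := hvanish _ (hu.analytic.dirDeriv _) (hvanish u hu.analytic h0) y hy
  have h := hu.eigen 0 y hy
  have hy' : (y : ℂ) ≠ 0 := ofReal_ne_zero.mpr hy.ne'
  rw [hyy, h0 y hy, add_zero, mul_zero] at h
  exact (mul_eq_zero.mp h).resolve_left (neg_ne_zero.mpr (pow_ne_zero 2 hy'))

theorem iteratedDeriv_fst_eq_zero (hu : IsAnalyticEigenfunction lam u)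
    (h0 : ∀ y : ℝ, 0 < y → u (0, y) = 0)
    (h1 : ∀ y : ℝ, 0 < y → dirDeriv (1, 0) u (0, y) = 0) (n : ℕ) (y : ℝ) (hy : 0 < y) :
    iteratedDeriv n (fun x : ℝ => u (x, y)) 0 = 0 := by
  induction n generalizing u with
  | zero => simpa using h0 y hy
  | succ n ih =>
    have hderiv : deriv (fun x : ℝ => u (x, y)) = fun x => dirDeriv (1, 0) u (x, y) :=
      funext fun x => (hu.analytic (x, y) hy).hasDerivAt_fst.deriv
    rw [iteratedDeriv_succ', hderiv]
    exact ih hu.dirDeriv_fst h1 (hu.dirDeriv_fst_fst_eq_zero h0)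

end IsAnalyticEigenfunction

/-- A real analytic function on the line all of whose derivatives vanish at a point is zero. -/
theorem AnalyticOnNhd.eq_zero_of_iteratedDeriv_eq_zero {g : ℝ → ℂ}
    (hg : AnalyticOnNhd ℝ g Set.univ) {a : ℝ} (h : ∀ n, iteratedDeriv n g a = 0) : g = 0 := by
  have hord : analyticOrderAt g a = ⊤ := ENat.eq_top_iff_forall_ge.mpr fun m =>
    (natCast_le_analyticOrderAt_iff_iteratedDeriv_eq_zero (hg a trivial)).mpr fun i _ => h i
  exact funext fun x => hg.eqOn_zero_of_preconnected_of_eventuallyEq_zero isPreconnected_univ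
    (Set.mem_univ a) (analyticOrderAt_eq_top.mp hord) (Set.mem_univ x)

/-- If `f` is real analytic on the upper half-plane (viewed as a function of the
two real variables `(x, y)` with `y > 0`), is an eigenfunction of the hyperbolic Laplacian
`Δ = -y² (∂²/∂x² + ∂²/∂y²)` with eigenvalue `λ`, and both `f` and `∂f/∂x` vanish on the
imaginary axis, then `f` is identically zero on the upper half-plane. -/
theorem statement_3 (f : ℝ × ℝ → ℂ) (lam : ℂ)
    (hf_analytic : AnalyticOnNhd ℝ f {p : ℝ × ℝ | 0 < p.2})
    (hf_eigen : ∀ x y : ℝ, 0 < y →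
      -(y : ℂ) ^ 2 * (deriv (fun x' : ℝ => deriv (fun x'' : ℝ => f (x'', y)) x') x
        + deriv (fun y' : ℝ => deriv (fun y'' : ℝ => f (x, y'')) y') y) = lam * f (x, y))
    (h0 : ∀ y : ℝ, 0 < y → f (0, y) = 0)
    (h0' : ∀ y : ℝ, 0 < y → deriv (fun x : ℝ => f (x, y)) 0 = 0) :
    ∀ x y : ℝ, 0 < y → f (x, y) = 0 := by
  have hfa : AnalyticOnNhd ℝ f upperHalf := hf_analytic
  have hf : IsAnalyticEigenfunction lam f := by
    refine ⟨hfa, fun x y hy => ?_⟩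
    rw [← hf_eigen x y hy]
    have hxx : deriv (fun x' : ℝ => deriv (fun x'' : ℝ => f (x'', y)) x') x
        = dirDeriv (1, 0) (dirDeriv (1, 0) f) (x, y) := by
      have : (fun x' : ℝ => deriv (fun x'' : ℝ => f (x'', y)) x')
          = fun x' => dirDeriv (1, 0) f (x', y) :=
        funext fun x' => (hfa (x', y) hy).hasDerivAt_fst.deriv
      rw [this]
      exact (hfa.dirDeriv (1, 0) (x, y) hy).hasDerivAt_fst.deriv
    have hyy : deriv (fun y' : ℝ => deriv (fun y'' : ℝ => f (x, y'')) y') y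
        = dirDeriv (0, 1) (dirDeriv (0, 1) f) (x, y) := by
      have : (fun y' : ℝ => deriv (fun y'' : ℝ => f (x, y'')) y')
          =ᶠ[nhds y] fun y' => dirDeriv (0, 1) f (x, y') :=
        Filter.eventuallyEq_of_mem (Ioi_mem_nhds hy) fun y' hy' =>
          (hfa (x, y') hy').hasDerivAt_snd.deriv
      rw [this.deriv_eq]
      exact (hfa.dirDeriv (0, 1) (x, y) hy).hasDerivAt_snd.deriv
    rw [hxx, hyy]
  have h1 : ∀ y : ℝ, 0 < y → dirDeriv (1, 0) f (0, y) = 0 := fun y hy => by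
    rw [← h0' y hy]
    exact (hfa (0, y) hy).hasDerivAt_fst.deriv.symm
  intro x y hy
  have hslice : AnalyticOnNhd ℝ (fun t : ℝ => f (t, y)) Set.univ := fun t _ =>
    AnalyticAt.fun_comp (g := f) (f := fun t : ℝ => (t, y)) (hfa (t, y) hy)
      (analyticAt_id.prod analyticAt_const)
  exact congrFun (hslice.eq_zero_of_iteratedDeriv_eq_zero
    fun n => hf.iteratedDeriv_fst_eq_zero h0 h1 n y hy) x
end

section
/- Let F be a real quadratic field of discriminant D, embedded in ℝ so that √D ∈ F denotes the positive square root of D; then the different ideal of F/ℚ equals (√D). Let p be a prime not dividing D, let σ be a primitive Dirichlet character modulo p with σ(−1) = (−1)^δ (δ ∈ {0,1}), and let χ_D be the quadratic Dirichlet character modulo D attached to F. Then (−1)^δ · Σ_{x ∈ O_F/pO_F} σ(N_{F/ℚ}(x̃) mod p) · e^{2πi Tr_{F/ℚ}(x̃/(p√D))} = D^{−1/2}·τ_ℚ(σ)·τ_ℚ(σχ_D) = σ(D)·χ_D(p)·τ_ℚ(σ)², where x̃ ∈ O_F is any lift of x (the sum is well defined since for z ∈ pO_F, Tr_{F/ℚ}(z/(p√D))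 ∈ ℤ), τ_ℚ(σ) = Σ_{a mod p} σ(a)e^{2πia/p}, and τ_ℚ(σχ_D) = Σ_{a mod pD} σ(a)χ_D(a)e^{2πia/(pD)} is the Gauss sum of the primitive character σχ_D modulo pD. -/
open NumberField
open scoped Real

section GaussSign

open Polynomial

theorem ZMod.sum_eval_eq_neg_coeff {p : ℕ} [Fact p.Prime] (P : (ZMod p)[X])
    (hP : P.natDegree < p) : ∑ x, P.eval x = -P.coeff (p - 1) := by
  have hp1 : 0 < p := (Fact.out : p.Prime).pos
  simp_rw [P.eval_eq_sum_range' hP]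
  rw [Finset.sum_comm]
  simp_rw [← Finset.mul_sum]
  obtain ⟨q, rfl⟩ : ∃ q, p = q + 1 := ⟨p - 1, by omega⟩
  have hq0 : q ≠ 0 := by
    rintro rfl
    exact Nat.not_prime_one (Fact.out : (0 + 1).Prime)
  rw [Finset.sum_range_succ, Finset.sum_eq_zero, zero_add, Nat.add_sub_cancel]
  · have : ∑ x : ZMod (q + 1), x ^ q = ∑ x : ZMod (q + 1), (1 - if x = 0 then 1 else 0) := by
      refine Finset.sum_congr rfl fun x _ ↦ ?_
      split_ifs with h
      · simp [h, hq0]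
      · simpa using ZMod.pow_card_sub_one_eq_one h
    rw [this, Finset.sum_sub_distrib, Finset.sum_ite_eq' Finset.univ]
    simp [ZMod.card]
  · intro i hi
    rw [FiniteField.sum_pow_lt_card_sub_one, mul_zero]
    simpa [ZMod.card] using hi

theorem ZMod.sum_quadraticChar_mul_descFactorial {m : ℕ} [Fact (2 * m + 1).Prime] :
    ∑ j ∈ Finset.range (2 * m + 1),
      ((quadraticChar (ZMod (2 * m + 1)) j : ℤ) : ZMod (2 * m + 1)) * (j.descFactorial m : ℕ) =
        -1 := by
  have hchar : ringChar (ZMod (2 * m + 1)) ≠ 2 := by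
    rw [ZMod.ringChar_zmod_n]; omega
  have hm := monic_descPochhammer (ZMod (2 * m + 1)) m
  have hd := descPochhammer_natDegree (ZMod (2 * m + 1)) m
  have hmon : (X ^ m * descPochhammer (ZMod (2 * m + 1)) m).Monic := (monic_X_pow m).mul hm
  have hdeg : (X ^ m * descPochhammer (ZMod (2 * m + 1)) m).natDegree = 2 * m := by
    rw [Monic.natDegree_mul (monic_X_pow m) hm, natDegree_X_pow, hd, two_mul]
  have := ZMod.sum_eval_eq_neg_coeff (p := 2 * m + 1)
    (X ^ m * descPochhammer (ZMod (2 * m + 1)) m) (by omega)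
  have hc := hmon.coeff_natDegree
  rw [hdeg] at hc
  rw [Nat.add_sub_cancel, hc] at this
  rw [← this, Finset.sum_range]
  refine Fintype.sum_equiv (ZMod.finEquiv (2 * m + 1)).toEquiv _ _ fun j ↦ ?_
  have hj : ((ZMod.finEquiv (2 * m + 1)).toEquiv j) = ((j : ℕ) : ZMod (2 * m + 1)) := by
    exact (ZMod.natCast_zmod_val (ZMod.finEquiv (2 * m + 1) j)).symm
  rw [hj, quadraticChar_eq_pow_of_char_ne_two' hchar, eval_mul,
    descPochhammer_eval_eq_descFactorial, eval_pow, eval_X, ZMod.card]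
  congr 3
  omega

theorem Polynomial.coeff_comp_prod_X_pow_sub_X_pow (R : Type*) [CommRing R] (m : ℕ) :
    ((∏ k ∈ Finset.range m, (X ^ ((k + 1) * (m + 1)) - X ^ ((k + 1) * m) : R[X])).comp
      (1 + X)).coeff m = (m.factorial : R) := by
  rw [prod_comp]
  have h : ∀ k : ℕ, (X ^ ((k + 1) * (m + 1)) - X ^ ((k + 1) * m) : R[X]).comp (1 + X) =
      divX ((1 + X) ^ ((k + 1) * (m + 1)) - (1 + X) ^ ((k + 1) * m) : R[X]) * X := by
    intro k
    conv_lhs => rw [sub_comp, X_pow_comp, X_pow_comp,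
      ← divX_mul_X_add ((1 + X) ^ ((k + 1) * (m + 1)) - (1 + X) ^ ((k + 1) * m) : R[X])]
    simp [coeff_one_add_X_pow]
  simp_rw [h]
  rw [Finset.prod_mul_distrib, Finset.prod_const, Finset.card_range, coeff_mul_X_pow',
    if_pos le_rfl, Nat.sub_self, coeff_zero_prod]
  simp only [coeff_divX, zero_add, coeff_sub, coeff_one_add_X_pow, Nat.choose_one_right]
  rw [← Finset.prod_range_add_one_eq_factorial]
  push_cast
  refine Finset.prod_congr rfl fun k _ ↦ by ring

theorem ZMod.factorial_sq_of_prime {m : ℕ} [Fact (2 * m + 1).Prime] :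
    (m.factorial : ZMod (2 * m + 1)) ^ 2 = (-1) ^ (m + 1) := by
  have h1 := ZMod.wilsons_lemma (2 * m + 1)
  have h0 : (2 * m).factorial = m.factorial * ∏ j ∈ Finset.range m, (m + (m - 1 - j) + 1) := by
    rw [← Finset.prod_range_add_one_eq_factorial, two_mul m, Finset.prod_range_add,
      Finset.prod_range_add_one_eq_factorial, ← Finset.prod_range_reflect]
  rw [Nat.add_sub_cancel, h0] at h1
  have h2 : ((∏ j ∈ Finset.range m, (m + (m - 1 - j) + 1) : ℕ) : ZMod (2 * m + 1)) =
      (-1) ^ m * m.factorial := by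
    rw [← Finset.prod_range_add_one_eq_factorial]
    have hc : ∏ _j ∈ Finset.range m, (-1 : ZMod (2 * m + 1)) = (-1) ^ m := by simp
    push_cast
    rw [← hc, ← Finset.prod_mul_distrib]
    refine Finset.prod_congr rfl fun j hj ↦ ?_
    have : ((m + (m - 1 - j) + 1 + (j + 1) : ℕ) : ZMod (2 * m + 1)) = 0 := by
      rw [show m + (m - 1 - j) + 1 + (j + 1) = 2 * m + 1 by
        have := Finset.mem_range.mp hj; omega]
      exact ZMod.natCast_self _
    push_cast at this
    linear_combination this
  rw [Nat.cast_mul, h2] at h1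
  have h3 : ((-1 : ZMod (2 * m + 1)) ^ m) * (-1) ^ m = 1 := by
    rw [← mul_pow]; simp
  rw [pow_succ]
  linear_combination (-1) ^ m * h1 - (m.factorial : ZMod (2 * m + 1)) ^ 2 * h3

/-- The product expressing the quadratic Gauss sum up to sign, in closed form. -/
theorem Complex.prod_exp_pow_sub_exp_pow (m : ℕ) :
    ∏ k ∈ Finset.range m,
      (Complex.exp (2 * π * I / (2 * m + 1 : ℕ)) ^ ((k + 1) * (m + 1)) -
        Complex.exp (2 * π * I / (2 * m + 1 : ℕ)) ^ ((k + 1) * m)) =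
      (∏ k ∈ Finset.range m, (-1) ^ (k + 1)) * I ^ m * (√(2 * m + 1 : ℕ) : ℝ) := by
  have hterm : ∀ k : ℕ, Complex.exp (2 * π * I / (2 * m + 1 : ℕ)) ^ ((k + 1) * (m + 1)) -
        Complex.exp (2 * π * I / (2 * m + 1 : ℕ)) ^ ((k + 1) * m) =
      (-1) ^ (k + 1) * I * ((2 * Real.sin (π * (k + 1) / (2 * m + 1)) : ℝ) : ℂ) := by
    intro k
    have hne : (2 * m + 1 : ℂ) * (2 * m + 1 : ℂ)⁻¹ = 1 :=
      mul_inv_cancel₀ (by exact_mod_cast Nat.succ_ne_zero (2 * m))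
    rw [← Complex.exp_nat_mul, ← Complex.exp_nat_mul]
    have e1 : (((k + 1) * (m + 1) : ℕ) : ℂ) * (2 * π * I / (2 * m + 1 : ℕ)) =
        ((k + 1 : ℕ) : ℂ) * (π * I) + (π * (k + 1) / (2 * m + 1)) * I := by
      push_cast; linear_combination (k + 1) * π * I * hne
    have e2 : (((k + 1) * m : ℕ) : ℂ) * (2 * π * I / (2 * m + 1 : ℕ)) =
        ((k + 1 : ℕ) : ℂ) * (π * I) + -(π * (k + 1) / (2 * m + 1)) * I := by
      push_cast; linear_combination (k + 1) * π * I * hne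
    rw [e1, e2, Complex.exp_add, Complex.exp_add, Complex.exp_nat_mul, Complex.exp_pi_mul_I]
    push_cast
    rw [Complex.two_sin]
    linear_combination (-(-1) ^ (k + 1) * (Complex.exp (-(π * (k + 1) / (2 * m + 1)) * I)
      - Complex.exp ((π * (k + 1) / (2 * m + 1)) * I))) * I_sq
  have hpos : ∀ k ∈ Finset.range m, 0 < 2 * Real.sin (π * (k + 1) / (2 * m + 1)) := by
    intro k hk
    have hk : (k : ℝ) + 1 ≤ m := by exact_mod_cast Finset.mem_range.mp hk
    refine mul_pos two_pos (Real.sin_pos_of_pos_of_lt_pi (by positivity) ?_)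
    rw [div_lt_iff₀ (by positivity)]
    exact mul_lt_mul_of_pos_left (by linarith) Real.pi_pos
  simp_rw [hterm]
  rw [Finset.prod_mul_distrib, Finset.prod_mul_distrib, Finset.prod_const, Finset.card_range,
    ← Complex.ofReal_prod]
  congr 2
  symm
  rw [Real.sqrt_eq_iff_eq_sq (by positivity) (Finset.prod_pos hpos).le]
  have hn := (Complex.isPrimitiveRoot_exp (2 * m + 1) (by omega)).prod_one_sub_pow_eq_order
  have hn' := congrArg norm hn
  rw [norm_prod] at hn'
  have hnorm : ∀ k : ℕ, ‖1 - Complex.exp (2 * π * I / (2 * m + 1 : ℕ)) ^ (k + 1)‖ =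
      |2 * Real.sin (π * (k + 1) / (2 * m + 1))| := by
    intro k
    rw [← Complex.exp_nat_mul, norm_sub_rev,
      show (((k + 1 : ℕ) : ℂ) * (2 * π * I / (2 * m + 1 : ℕ))) =
        I * ((2 * (π * (k + 1) / (2 * m + 1)) : ℝ) : ℂ) by push_cast; ring,
      Complex.norm_exp_I_mul_ofReal_sub_one, Real.norm_eq_abs]
    congr 3
    ring
  simp_rw [hnorm] at hn'
  rw [two_mul m, Finset.prod_range_add, ← Finset.prod_range_reflect (n := m)
    (f := fun x ↦ |2 * Real.sin (π * ((m + x : ℕ) + 1) / (2 * m + 1))|)] at hn'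
  have hrefl : ∏ j ∈ Finset.range m, |2 * Real.sin (π * ((m + (m - 1 - j) : ℕ) + 1) / (2 * m + 1))|
      = ∏ j ∈ Finset.range m, |2 * Real.sin (π * (j + 1) / (2 * m + 1))| := by
    refine Finset.prod_congr rfl fun j hj ↦ ?_
    have hj := Finset.mem_range.mp hj
    rw [← Real.sin_pi_sub]
    congr 3
    have : ((m + (m - 1 - j) : ℕ) : ℝ) = 2 * m - 1 - j := by
      rw [show m + (m - 1 - j) = 2 * m - (1 + j) by omega, Nat.cast_sub (by omega)]
      push_cast; ring
    rw [this]
    field_simp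
    ring
  rw [hrefl, Finset.prod_congr rfl fun k hk ↦ abs_of_pos (hpos k hk)] at hn'
  rw [sq, hn']
  rw [show ((m + m : ℕ) : ℂ) + 1 = ((2 * m + 1 : ℕ) : ℂ) by push_cast; ring, Complex.norm_natCast]


theorem ZMod.gaussSum_quadraticChar_sq {p : ℕ} [Fact p.Prime] (hp : p ≠ 2) :
    gaussSum ((quadraticChar (ZMod p)).ringHomComp (Int.castRingHom ℂ)) ZMod.stdAddChar ^ 2 =
      (-1) ^ (p / 2) * p := by
  have hchar : ringChar (ZMod p) ≠ 2 := by rwa [ZMod.ringChar_zmod_n]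
  rw [gaussSum_sq, MulChar.ringHomComp_apply, quadraticChar_neg_one hchar, ZMod.card,
    ZMod.χ₄_eq_neg_one_pow ((Fact.out : p.Prime).mod_two_eq_one_iff_ne_two.mpr hp)]
  · simp
  · intro h
    refine quadraticChar_ne_one hchar (MulChar.ext fun a ↦ ?_)
    have := congrFun (congrArg (fun f : MulChar (ZMod p) ℂ ↦ (f : ZMod p → ℂ)) h) a
    simpa [MulChar.ringHomComp_apply] using this
  · exact (quadraticChar_isQuadratic _).comp _
  · exact ZMod.isPrimitive_stdAddChar p

/-- The sign of the quadratic Gauss sum. -/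
theorem ZMod.gaussSum_quadraticChar_two_mul_add_one {m : ℕ} [Fact (2 * m + 1).Prime] (hm0 : m ≠ 0) :
    gaussSum ((quadraticChar (ZMod (2 * m + 1))).ringHomComp (Int.castRingHom ℂ))
      ZMod.stdAddChar =
      (-1) ^ m * ((∏ k ∈ Finset.range m, (-1) ^ (k + 1)) * Complex.I ^ m *
        (√(2 * m + 1 : ℕ) : ℝ)) := by
  have hp : (2 * m + 1).Prime := Fact.out
  rw [← Complex.prod_exp_pow_sub_exp_pow]
  set ζ : ℂ := Complex.exp (2 * π * Complex.I / (2 * m + 1 : ℕ)) with hζ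
  set S : ℤ[X] := ∑ j ∈ Finset.range (2 * m + 1),
    C (quadraticChar (ZMod (2 * m + 1)) j) * X ^ j with hS
  set Q : ℤ[X] := ∏ k ∈ Finset.range m, (X ^ ((k + 1) * (m + 1)) - X ^ ((k + 1) * m)) with hQ
  have hprim : IsPrimitiveRoot ζ (2 * m + 1) := Complex.isPrimitiveRoot_exp _ (by omega)
  have hSζ : aeval ζ S =
      gaussSum ((quadraticChar (ZMod (2 * m + 1))).ringHomComp (Int.castRingHom ℂ))
        ZMod.stdAddChar := by
    rw [hS, map_sum, Finset.sum_range, gaussSum]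
    refine Fintype.sum_equiv (ZMod.finEquiv (2 * m + 1)).toEquiv _ _ fun j ↦ ?_
    have hj : ((ZMod.finEquiv (2 * m + 1)).toEquiv j) = ((j : ℕ) : ZMod (2 * m + 1)) :=
      (ZMod.natCast_zmod_val (ZMod.finEquiv (2 * m + 1) j)).symm
    rw [hj, MulChar.ringHomComp_apply]
    have : ZMod.stdAddChar (((j : ℕ) : ZMod (2 * m + 1))) = ζ ^ (j : ℕ) := by
      have := ZMod.stdAddChar_coe (N := 2 * m + 1) (j : ℕ)
      rw [Int.cast_natCast] at this
      rw [this, hζ, ← Complex.exp_nat_mul]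
      congr 1
      push_cast
      ring
    rw [this]
    simp
  have hQζ : aeval ζ Q = ∏ k ∈ Finset.range m,
      (ζ ^ ((k + 1) * (m + 1)) - ζ ^ ((k + 1) * m)) := by
    simp [hQ, map_prod]
  rw [← hQζ, ← hSζ]
  have hsq : aeval ζ S ^ 2 = aeval ζ Q ^ 2 := by
    rw [hSζ, hQζ, Complex.prod_exp_pow_sub_exp_pow,
      ZMod.gaussSum_quadraticChar_sq (by omega), mul_pow, mul_pow, ← pow_mul, mul_comm m 2,
      pow_mul, Complex.I_sq, ← Finset.prod_pow]
    have h1 : ∀ k : ℕ, (((-1 : ℂ) ^ (k + 1)) ^ 2) = 1 := fun k ↦ by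
      rw [← pow_mul, mul_comm, pow_mul]; simp
    rw [← Complex.ofReal_pow, Real.sq_sqrt (by positivity)]
    simp only [h1, Finset.prod_const_one, one_mul]
    rw [show (2 * m + 1) / 2 = m by omega]
    simp
  obtain ⟨ε, hε, hεS⟩ : ∃ ε : ℤ, (ε = 1 ∨ ε = -1) ∧ aeval ζ S = ε * aeval ζ Q := by
    rcases sq_eq_sq_iff_eq_or_eq_neg.mp hsq with h | h
    · exact ⟨1, Or.inl rfl, by simp [h]⟩
    · exact ⟨-1, Or.inr rfl, by simp [h]⟩
  rw [hεS]
  congr 1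
  have hdvd : cyclotomic (2 * m + 1) ℤ ∣ S - C ε * Q := by
    rw [cyclotomic_eq_minpoly hprim (by omega)]
    refine minpoly.isIntegrallyClosed_dvd (hprim.isIntegral (by omega)) ?_
    simp [hεS]
  let φ := Int.castRingHom (ZMod (2 * m + 1))
  have hcyc : (cyclotomic (2 * m + 1) (ZMod (2 * m + 1))) = (X - 1) ^ (2 * m) := by
    have h := cyclotomic_prime_mul_X_sub_one (ZMod (2 * m + 1)) (2 * m + 1)
    have h' := sub_pow_char (X : (ZMod (2 * m + 1))[X]) 1 (p := 2 * m + 1)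
    rw [one_pow] at h'
    rw [← h', pow_succ] at h
    exact mul_right_cancel₀ (by simpa using X_sub_C_ne_zero (1 : ZMod (2 * m + 1))) h
  have hdvd2 : X ^ (2 * m) ∣ ((S - C ε * Q).map φ).comp (1 + X) := by
    have h1 : (X - 1) ^ (2 * m) ∣ (S - C ε * Q).map φ := by
      have := Polynomial.map_dvd φ hdvd
      rwa [map_cyclotomic, hcyc] at this
    obtain ⟨r, hr⟩ := h1
    refine ⟨r.comp (1 + X), ?_⟩
    rw [hr, mul_comp, pow_comp]
    simp
  have hcoeff := X_pow_dvd_iff.mp hdvd2 m (by omega)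
  rw [Polynomial.map_sub, Polynomial.map_mul, sub_comp, mul_comp, coeff_sub, map_C, C_comp,
    coeff_C_mul, hQ, Polynomial.map_prod] at hcoeff
  simp only [Polynomial.map_sub, Polynomial.map_pow, map_X] at hcoeff
  rw [coeff_comp_prod_X_pow_sub_X_pow] at hcoeff
  have hScoeff : (m.factorial : ZMod (2 * m + 1)) * ((S.map φ).comp (1 + X)).coeff m = -1 := by
    rw [← ZMod.sum_quadraticChar_mul_descFactorial, hS, Polynomial.map_sum, Polynomial.sum_comp,
      finsetSum_coeff, Finset.mul_sum]
    refine Finset.sum_congr rfl fun j _ ↦ ?_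
    rw [Polynomial.map_mul, map_C, Polynomial.map_pow, map_X, mul_comp, C_comp, X_pow_comp,
      coeff_C_mul, coeff_one_add_X_pow, Nat.descFactorial_eq_factorial_mul_choose]
    simp only [φ, eq_intCast]
    push_cast
    ring
  have hfac := ZMod.factorial_sq_of_prime (m := m)
  have hεm : ((ε : ℤ) : ZMod (2 * m + 1)) = (((-1) ^ m : ℤ) : ZMod (2 * m + 1)) := by
    have h3 : ((-1 : ZMod (2 * m + 1)) ^ m) * (-1) ^ m = 1 := by
      rw [← mul_pow]; simp
    rw [pow_succ] at hfac
    simp only [φ, eq_intCast] at hcoeff hScoeff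
    push_cast
    linear_combination (m.factorial : ZMod (2 * m + 1)) * (-1) ^ m * hcoeff - (-1) ^ m * hScoeff
      + (-1) ^ m * ε * hfac - (ε : ZMod (2 * m + 1)) * h3
  have hne : ((1 : ℤ) : ZMod (2 * m + 1)) ≠ ((-1 : ℤ) : ZMod (2 * m + 1)) := by
    intro h
    rw [ZMod.intCast_eq_intCast_iff_dvd_sub] at h
    have := Int.le_of_dvd (by norm_num) ((dvd_neg).mpr h)
    push_cast at this
    omega
  rcases hε with rfl | rfl <;> rcases neg_one_pow_eq_or ℤ m with h | h
  · have : ((-1 : ℂ)) ^ m = 1 := by exact_mod_cast h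
    simp [this]
  · exact absurd (h ▸ hεm) hne
  · exact absurd (h ▸ hεm).symm hne
  · have : ((-1 : ℂ)) ^ m = -1 := by exact_mod_cast h
    simp [this]

/-- The normalised value `1` or `i` of the quadratic Gauss sum modulo an odd number. -/
noncomputable def gaussSign (n : ℕ) : ℂ := if n % 4 = 1 then 1 else Complex.I

theorem prod_neg_one_pow_mul_I_pow (m : ℕ) :
    (-1) ^ m * ((∏ k ∈ Finset.range m, (-1) ^ (k + 1)) * Complex.I ^ m) =
      gaussSign (2 * m + 1) := by
  have key : ∀ n r : ℕ, (-1 : ℂ) ^ (4 * n + r) = (-1) ^ r ∧ Complex.I ^ (4 * n + r) = Complex.I ^ r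
      ∧ ∏ k ∈ Finset.range (4 * n), (-1 : ℂ) ^ (k + 1) = 1 := by
    intro n r
    have h4 : (-1 : ℂ) ^ 4 = 1 := by norm_num
    refine ⟨by simp [pow_add, pow_mul, h4], by simp [pow_add, pow_mul], ?_⟩
    induction n with
    | zero => simp
    | succ n ih =>
      rw [show 4 * (n + 1) = 4 * n + 1 + 1 + 1 + 1 by ring]
      rw [Finset.prod_range_succ, Finset.prod_range_succ, Finset.prod_range_succ,
        Finset.prod_range_succ, ih]
      simp only [pow_add, pow_mul, h4]
      norm_num
  obtain ⟨n, r, hr, rfl⟩ : ∃ n r, r < 4 ∧ m = 4 * n + r :=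
    ⟨m / 4, m % 4, Nat.mod_lt _ (by norm_num), by omega⟩
  obtain ⟨h1, h2, h3⟩ := key n r
  rw [h1, h2, Finset.prod_range_add, h3]
  simp only [add_assoc, (key n _).1]
  unfold gaussSign
  interval_cases r
  · rw [if_pos (by omega)]; simp
  · rw [if_neg (by omega)]; simp
  · rw [if_pos (by omega)]; simp [Finset.prod_range_succ]
  · rw [if_neg (by omega)]; simp [Finset.prod_range_succ, pow_succ]

theorem ZMod.gaussSum_quadraticChar {p : ℕ} [Fact p.Prime] (hp : p ≠ 2) :
    gaussSum ((quadraticChar (ZMod p)).ringHomComp (Int.castRingHom ℂ)) ZMod.stdAddChar =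
      gaussSign p * (√p : ℝ) := by
  have hodd := (Fact.out : p.Prime).mod_two_eq_one_iff_ne_two.mpr hp
  have h1 := (Fact.out : p.Prime).one_lt
  obtain ⟨m, rfl⟩ : ∃ m, p = 2 * m + 1 := ⟨p / 2, by omega⟩
  rw [ZMod.gaussSum_quadraticChar_two_mul_add_one (by omega), ← prod_neg_one_pow_mul_I_pow]
  ring

end GaussSign

section Character
open scoped NumberTheorySymbols

theorem ZMod.stdAddChar_natCast {N : ℕ} [NeZero N] (j : ℕ) :
    ZMod.stdAddChar (j : ZMod N) = Complex.exp (2 * π * Complex.I * j / N) := by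
  have := ZMod.stdAddChar_coe (N := N) (j : ℤ)
  simpa using this

theorem ZMod.sum_mul_stdAddChar_of_coprime {m n : ℕ} [NeZero m] [NeZero n] (h : m.Coprime n)
    (f : ZMod m → ℂ) (g : ZMod n → ℂ) :
    ∑ x : ZMod (m * n), f (ZMod.castHom (dvd_mul_right m n) (ZMod m) x) *
      g (ZMod.castHom (dvd_mul_left n m) (ZMod n) x) * ZMod.stdAddChar x =
    (∑ a : ZMod m, f (a * n) * ZMod.stdAddChar a) *
      ∑ b : ZMod n, g (b * m) * ZMod.stdAddChar b := by
  rw [Fintype.sum_mul_sum, ← Fintype.sum_prod_type']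
  let Φ : ZMod m × ZMod n → ZMod (m * n) := fun x ↦ ((x.1.val * n + x.2.val * m : ℕ) : ZMod _)
  have h1 : ∀ x, ZMod.castHom (dvd_mul_right m n) (ZMod m) (Φ x) = x.1 * n := fun x ↦ by
    simp [Φ, -ZMod.castHom_apply, map_natCast]
  have h2 : ∀ x, ZMod.castHom (dvd_mul_left n m) (ZMod n) (Φ x) = x.2 * m := fun x ↦ by
    simp [Φ, -ZMod.castHom_apply, map_natCast]
  have hinj : Function.Injective Φ := by
    intro x y hxy
    have e1 := congrArg (ZMod.castHom (dvd_mul_right m n) (ZMod m)) hxy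
    have e2 := congrArg (ZMod.castHom (dvd_mul_left n m) (ZMod n)) hxy
    rw [h1, h1] at e1
    rw [h2, h2] at e2
    exact Prod.ext (((ZMod.isUnit_iff_coprime n m).mpr h.symm).mul_right_cancel e1)
      (((ZMod.isUnit_iff_coprime m n).mpr h).mul_right_cancel e2)
  have hbij : Function.Bijective Φ := by
    rw [Fintype.bijective_iff_injective_and_card]
    exact ⟨hinj, by simp [ZMod.card]⟩
  symm
  refine Fintype.sum_equiv (Equiv.ofBijective Φ hbij) _ _ fun x ↦ ?_
  rw [Equiv.ofBijective_apply, h1, h2]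
  have h3 : ZMod.stdAddChar (Φ x) = ZMod.stdAddChar x.1 * ZMod.stdAddChar x.2 := by
    conv_rhs => rw [← ZMod.natCast_zmod_val x.1, ← ZMod.natCast_zmod_val x.2]
    rw [ZMod.stdAddChar_natCast, ZMod.stdAddChar_natCast, ZMod.stdAddChar_natCast,
      ← Complex.exp_add]
    congr 1
    have hm : (m : ℂ) ≠ 0 := NeZero.ne _
    have hn : (n : ℂ) ≠ 0 := NeZero.ne _
    push_cast
    field_simp
  rw [h3]
  ring

theorem DirichletCharacter.exists_mul_of_coprime {m n : ℕ} [NeZero m] [NeZero n]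
    (h : m.Coprime n) (χ : DirichletCharacter ℂ m) (ψ : DirichletCharacter ℂ n) :
    ∃ φ : DirichletCharacter ℂ (m * n), (∀ a : ℕ, φ a = χ a * ψ a) ∧
      gaussSum φ ZMod.stdAddChar =
        χ n * ψ m * (gaussSum χ ZMod.stdAddChar * gaussSum ψ ZMod.stdAddChar) := by
  have hval : ∀ x : ZMod (m * n), (changeLevel (dvd_mul_right m n) χ *
      changeLevel (dvd_mul_left n m) ψ) x = χ (ZMod.castHom (dvd_mul_right m n) (ZMod m) x) *
      ψ (ZMod.castHom (dvd_mul_left n m) (ZMod n) x) := by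
    intro x
    by_cases hx : IsUnit x
    · obtain ⟨u, rfl⟩ := hx
      rw [MulChar.mul_apply, changeLevel_eq_cast_of_dvd, changeLevel_eq_cast_of_dvd]
      rfl
    · rw [MulChar.map_nonunit _ hx]
      rw [← ZMod.natCast_zmod_val x, ZMod.isUnit_iff_coprime, Nat.coprime_mul_iff_right,
        not_and_or] at hx
      rw [← ZMod.natCast_zmod_val x, map_natCast (ZMod.castHom (dvd_mul_right m n) (ZMod m)),
        map_natCast (ZMod.castHom (dvd_mul_left n m) (ZMod n))]
      rcases hx with hx | hx
      · rw [MulChar.map_nonunit χ (by rwa [ZMod.isUnit_iff_coprime]), zero_mul]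
      · rw [MulChar.map_nonunit ψ (by rwa [ZMod.isUnit_iff_coprime]), mul_zero]
  refine ⟨changeLevel (dvd_mul_right m n) χ * changeLevel (dvd_mul_left n m) ψ, fun a ↦ ?_, ?_⟩
  · rw [hval, map_natCast (ZMod.castHom (dvd_mul_right m n) (ZMod m)),
        map_natCast (ZMod.castHom (dvd_mul_left n m) (ZMod n))]
  · simp only [gaussSum, hval]
    rw [ZMod.sum_mul_stdAddChar_of_coprime h]
    simp only [map_mul, Finset.mul_sum, Finset.sum_mul]
    refine Finset.sum_congr rfl fun a _ ↦ Finset.sum_congr rfl fun b _ ↦ by ring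

theorem gaussSign_mul {a b : ℕ} (ha : Odd a) (hb : Odd b) (hab : a.Coprime b) :
    (J(b | a) : ℂ) * J(a | b) * (gaussSign a * gaussSign b) = gaussSign (a * b) := by
  have hsq : (J(a | b) : ℂ) ^ 2 = 1 := by
    exact_mod_cast jacobiSym.sq_one (a := a) (b := b) (by simpa using hab)
  have ha' := Nat.odd_iff.mp ha
  have hb' := Nat.odd_iff.mp hb
  unfold gaussSign
  rcases (by omega : a % 4 = 1 ∨ a % 4 = 3) with h1 | h1 <;>
  rcases (by omega : b % 4 = 1 ∨ b % 4 = 3) with h2 | h2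
  · rw [← jacobiSym.quadratic_reciprocity_one_mod_four h1 hb]
    simp [Nat.mul_mod, h1, h2, ← sq, hsq]
  · rw [← jacobiSym.quadratic_reciprocity_one_mod_four h1 hb]
    simp [Nat.mul_mod, h1, h2, ← sq, hsq]
  · rw [← jacobiSym.quadratic_reciprocity_one_mod_four' ha h2]
    simp [Nat.mul_mod, h1, h2, ← sq, hsq]
  · rw [jacobiSym.quadratic_reciprocity_three_mod_four h2 h1]
    simp [Nat.mul_mod, h1, h2, ← sq, hsq]

theorem exists_dirichletCharacter_jacobiSym_right (k : ℕ) [NeZero k] (hk : Odd k)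
    (hsf : Squarefree k) :
    ∃ χ : DirichletCharacter ℂ k, (∀ a : ℕ, χ a = J(a | k)) ∧
      gaussSum χ ZMod.stdAddChar = gaussSign k * (√k : ℝ) := by
  revert hk hsf
  rename_i inst
  revert inst
  induction k using Nat.recOnPrimeCoprime with
  | zero => intro inst; exact absurd rfl inst.ne
  | prime_pow p n hp =>
    intro inst hk hsf
    have : Fact p.Prime := ⟨hp⟩
    rcases Nat.eq_zero_or_pos n with rfl | hn
    · revert inst
      rw [pow_zero]
      intro inst
      refine ⟨1, fun a ↦ ?_, ?_⟩
      · rw [Subsingleton.elim (a : ZMod 1) 1]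
        simp
      · have h1 : ∀ x : ZMod 1, (1 : DirichletCharacter ℂ 1) x * ZMod.stdAddChar x = 1 := by
          intro x
          rw [Subsingleton.elim x 0, AddChar.map_zero_eq_one, Subsingleton.elim (0 : ZMod 1) 1,
            map_one, one_mul]
        simp [gaussSum, h1, gaussSign]
    · obtain rfl : n = 1 := by
        by_contra hn1
        have := (Nat.squarefree_pow_iff hp.ne_one (by omega)).mp hsf
        exact hn1 this.2
      revert inst
      rw [pow_one]
      intro inst
      have hp2 : p ≠ 2 := by
        rintro rfl
        exact absurd hk (by decide)
      refine ⟨(quadraticChar (ZMod p)).ringHomComp (Int.castRingHom ℂ), fun a ↦ ?_,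
        ZMod.gaussSum_quadraticChar hp2⟩
      rw [← jacobiSym.legendreSym.to_jacobiSym, legendreSym]
      simp [MulChar.ringHomComp_apply]
  | coprime a b ha hb hab iha ihb =>
    intro inst hk hsf
    have : NeZero a := ⟨by omega⟩
    have : NeZero b := ⟨by omega⟩
    rw [Nat.odd_mul] at hk
    have hsf' := Nat.squarefree_mul hab |>.mp hsf
    obtain ⟨χ, hχ, hχg⟩ := iha hk.1 hsf'.1
    obtain ⟨ψ, hψ, hψg⟩ := ihb hk.2 hsf'.2
    obtain ⟨φ, hφ, hφg⟩ := DirichletCharacter.exists_mul_of_coprime hab χ ψ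
    refine ⟨φ, fun n ↦ ?_, ?_⟩
    · rw [hφ, hχ, hψ, jacobiSym.mul_right]
      push_cast
      rfl
    · rw [← gaussSign_mul hk.1 hk.2 hab]
      convert hφg using 1
      rw [hχ, hψ, hχg, hψg, Nat.cast_mul, Real.sqrt_mul (by positivity)]
      push_cast
      ring


theorem gaussSum_χ₄ :
    gaussSum (ZMod.χ₄.ringHomComp (Int.castRingHom ℂ)) ZMod.stdAddChar = 2 * Complex.I := by
  have h1 : ZMod.stdAddChar (1 : ZMod 4) = Complex.I := by
    have := ZMod.stdAddChar_natCast (N := 4) 1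
    rw [Nat.cast_one] at this
    rw [this, show 2 * π * Complex.I * (1 : ℕ) / (4 : ℕ) = π / 2 * Complex.I by push_cast; ring,
      Complex.exp_pi_div_two_mul_I]
  have h3 : ZMod.stdAddChar (3 : ZMod 4) = -Complex.I := by
    rw [show (3 : ZMod 4) = 1 + 1 + 1 by decide, AddChar.map_add_eq_mul, AddChar.map_add_eq_mul, h1]
    simp
  have : ∀ f : ZMod 4 → ℂ, ∑ x, f x = f 0 + f 1 + f 2 + f 3 := fun f ↦ Fin.sum_univ_four f
  rw [gaussSum, this]
  simp only [MulChar.ringHomComp_apply, h1, h3, show ZMod.χ₄ 0 = 0 by decide,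
    show ZMod.χ₄ 1 = 1 by decide, show ZMod.χ₄ 2 = 0 by decide, show ZMod.χ₄ 3 = -1 by decide]
  simp
  ring

theorem stdAddChar_one_zmod_eight :
    ZMod.stdAddChar (1 : ZMod 8) = (√2 : ℝ) / 2 * (1 + Complex.I) := by
  have := ZMod.stdAddChar_natCast (N := 8) 1
  rw [Nat.cast_one] at this
  rw [this, show 2 * π * Complex.I * (1 : ℕ) / (8 : ℕ) = ((π / 4 : ℝ) : ℂ) * Complex.I by
    push_cast; ring, Complex.exp_mul_I, ← Complex.ofReal_cos, ← Complex.ofReal_sin,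
    Real.cos_pi_div_four, Real.sin_pi_div_four]
  push_cast
  ring

theorem ZMod.sum_mul_stdAddChar_eight (f : ZMod 8 → ℂ) (hf : f 0 = 0 ∧ f 2 = 0 ∧ f 4 = 0 ∧ f 6 = 0) :
    ∑ x, f x * ZMod.stdAddChar x = (√2 : ℝ) / 2 *
      ((f 1 + f 7 - f 3 - f 5) + (f 1 + f 3 - f 5 - f 7) * Complex.I) := by
  have hsum : ∀ f : ZMod 8 → ℂ, ∑ x, f x = f 0 + f 1 + f 2 + f 3 + f 4 + f 5 + f 6 + f 7 :=
    fun f ↦ Fin.sum_univ_eight f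
  have hpow : ∀ k : ℕ, ZMod.stdAddChar (k : ZMod 8) = ZMod.stdAddChar (1 : ZMod 8) ^ k := by
    intro k
    rw [← AddChar.map_nsmul_eq_pow, nsmul_one]
  have h2 : ZMod.stdAddChar (1 : ZMod 8) ^ 2 = Complex.I := by
    have hs : ((√2 : ℝ) : ℂ) ^ 2 = 2 := by
      rw [← Complex.ofReal_pow, Real.sq_sqrt (by norm_num)]; simp
    rw [stdAddChar_one_zmod_eight]
    linear_combination ((1 + Complex.I) ^ 2 / 4) * hs + (1 / 2 : ℂ) * Complex.I_sq
  have h3 := hpow 3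
  have h5 := hpow 5
  have h7 := hpow 7
  rw [hsum, hf.1, hf.2.1, hf.2.2.1, hf.2.2.2]
  push_cast at h3 h5 h7
  rw [pow_succ, h2] at h3
  rw [show ZMod.stdAddChar (1 : ZMod 8) ^ 5 =
    (ZMod.stdAddChar (1 : ZMod 8) ^ 2) ^ 2 * ZMod.stdAddChar (1 : ZMod 8) by ring, h2,
    Complex.I_sq] at h5
  rw [show ZMod.stdAddChar (1 : ZMod 8) ^ 7 =
    (ZMod.stdAddChar (1 : ZMod 8) ^ 2) ^ 3 * ZMod.stdAddChar (1 : ZMod 8) by ring, h2,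
    pow_succ, Complex.I_sq] at h7
  rw [h3, h5, h7, stdAddChar_one_zmod_eight]
  linear_combination ((f 3 - f 7) * (√2 : ℝ) / 2) * Complex.I_sq

theorem gaussSum_χ₈ :
    gaussSum (ZMod.χ₈.ringHomComp (Int.castRingHom ℂ)) ZMod.stdAddChar = 2 * (√2 : ℝ) := by
  rw [gaussSum, ZMod.sum_mul_stdAddChar_eight _ (by
    simp [MulChar.ringHomComp_apply])]
  simp only [MulChar.ringHomComp_apply, show ZMod.χ₈ 1 = 1 by decide,
    show ZMod.χ₈ 3 = -1 by decide, show ZMod.χ₈ 5 = -1 by decide, show ZMod.χ₈ 7 = 1 by decide]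
  simp
  ring

theorem gaussSum_χ₈' :
    gaussSum (ZMod.χ₈'.ringHomComp (Int.castRingHom ℂ)) ZMod.stdAddChar =
      2 * (√2 : ℝ) * Complex.I := by
  rw [gaussSum, ZMod.sum_mul_stdAddChar_eight _ (by
    simp [MulChar.ringHomComp_apply])]
  simp only [MulChar.ringHomComp_apply, show ZMod.χ₈' 1 = 1 by decide,
    show ZMod.χ₈' 3 = 1 by decide, show ZMod.χ₈' 5 = -1 by decide, show ZMod.χ₈' 7 = -1 by decide]
  simp
  ring

/-- `D` is a positive fundamental discriminant (`D = 1` being allowed). -/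
def IsPosFundamental (D : ℕ) : Prop :=
  (D % 4 = 1 ∧ Squarefree D) ∨ ∃ m, D = 4 * m ∧ Squarefree m ∧ (m % 4 = 2 ∨ m % 4 = 3)

theorem exists_dirichletCharacter_jacobiSym_left (D : ℕ) [NeZero D] (h : IsPosFundamental D) :
    ∃ χ : DirichletCharacter ℂ D, (∀ n : ℕ, Odd n → χ n = J(D | n)) ∧
      gaussSum χ ZMod.stdAddChar = (√D : ℝ) := by
  rcases h with ⟨hD, hsf⟩ | ⟨m, rfl, hsf, hm⟩
  · obtain ⟨χ, hχ, hg⟩ := exists_dirichletCharacter_jacobiSym_right D (Nat.odd_iff.mpr (by omega)) hsf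
    refine ⟨χ, fun n hn ↦ ?_, by simp [hg, gaussSign, hD]⟩
    rw [hχ, jacobiSym.quadratic_reciprocity_one_mod_four hD hn]
  · have hm0 : NeZero m := ⟨by rintro rfl; omega⟩
    rcases hm with hm | hm
    · obtain ⟨k, rfl⟩ : ∃ k, m = 2 * k := ⟨m / 2, by omega⟩
      have hk : Odd k := Nat.odd_iff.mpr (by omega)
      have hk0 : NeZero k := ⟨by rintro rfl; omega⟩
      have hc : Nat.Coprime 8 k := (Nat.coprime_two_left.mpr hk).pow_left 3
      obtain ⟨ψ, hψ, hψg⟩ := exists_dirichletCharacter_jacobiSym_right k hk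
        (hsf.squarefree_of_dvd (dvd_mul_left k 2))
      have h8 : J((8 : ℕ) | k) = ZMod.χ₈ k := by
        rw [← jacobiSym.at_two hk, show ((8 : ℕ) : ℤ) = 4 * 2 by norm_num, jacobiSym.mul_left,
          jacobiSym.at_four hk, one_mul]
      have hsq : (ZMod.χ₈ k : ℂ) ^ 2 = 1 := by
        rw [← jacobiSym.at_two hk]
        exact_mod_cast jacobiSym.sq_one (a := 2) (b := k) (by
          exact Nat.coprime_two_left.mpr hk)
      have hJ : ∀ n : ℕ, Odd n → J((8 * k : ℕ) | n) = ZMod.χ₈ n * J(k | n) := by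
        intro n hn
        rw [← jacobiSym.at_two hn, show ((8 * k : ℕ) : ℤ) = 4 * 2 * k by push_cast; ring,
          jacobiSym.mul_left, jacobiSym.mul_left, jacobiSym.at_four hn, one_mul]
      have hsqrt : (√(8 * k : ℕ) : ℝ) = 2 * √2 * √k := by
        rw [show ((8 * k : ℕ) : ℝ) = 2 ^ 2 * 2 * k by push_cast; ring, Real.sqrt_mul (by positivity),
          Real.sqrt_mul (by positivity), Real.sqrt_sq (by norm_num)]
      rename_i inst
      revert inst
      rw [← mul_assoc, show 4 * 2 = 8 by norm_num]
      intro inst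
      rcases (by omega : k % 4 = 1 ∨ k % 4 = 3) with hk4 | hk4
      · obtain ⟨φ, hφ, hφg⟩ := DirichletCharacter.exists_mul_of_coprime hc
          (ZMod.χ₈.ringHomComp (Int.castRingHom ℂ)) ψ
        refine ⟨φ, fun n hn ↦ ?_, ?_⟩
        · rw [hφ, hψ, hJ n hn, jacobiSym.quadratic_reciprocity_one_mod_four hk4 hn]
          simp [MulChar.ringHomComp_apply]
        · rw [show gaussSum φ ZMod.stdAddChar = _ from hφg, hψ, hψg, gaussSum_χ₈, h8, hsqrt,
            gaussSign, if_pos hk4, MulChar.ringHomComp_apply]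
          push_cast
          linear_combination (2 * (√2 : ℝ) * (√k : ℝ) : ℂ) * hsq
      · obtain ⟨φ, hφ, hφg⟩ := DirichletCharacter.exists_mul_of_coprime hc
          (ZMod.χ₈'.ringHomComp (Int.castRingHom ℂ)) ψ
        have h8' : ∀ n : ℕ, ZMod.χ₈' n = ZMod.χ₄ n * ZMod.χ₈ n := fun n ↦ by
          exact_mod_cast ZMod.χ₈'_int_eq_χ₄_mul_χ₈ n
        refine ⟨φ, fun n hn ↦ ?_, ?_⟩
        · rw [hφ, hψ, hJ n hn, MulChar.ringHomComp_apply, h8']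
          rcases (by have := Nat.odd_iff.mp hn; omega : n % 4 = 1 ∨ n % 4 = 3) with hn4 | hn4
          · rw [jacobiSym.quadratic_reciprocity_one_mod_four' hk hn4, ZMod.χ₄_nat_one_mod_four hn4]
            simp
          · rw [jacobiSym.quadratic_reciprocity_three_mod_four hk4 hn4,
              ZMod.χ₄_nat_three_mod_four hn4]
            simp
        · rw [show gaussSum φ ZMod.stdAddChar = _ from hφg, hψ, hψg, gaussSum_χ₈', h8, hsqrt,
            gaussSign, if_neg (by omega), MulChar.ringHomComp_apply, eq_intCast, h8',
            ZMod.χ₄_nat_three_mod_four hk4]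
          push_cast
          linear_combination (2 * (√2 : ℝ) * (√k : ℝ) : ℂ) * hsq -
            (2 * (√2 : ℝ) * (√k : ℝ) * ZMod.χ₈ k ^ 2 : ℂ) * Complex.I_sq
    · have hk : Odd m := Nat.odd_iff.mpr (by omega)
      have hc : Nat.Coprime 4 m := (Nat.coprime_two_left.mpr hk).pow_left 2
      obtain ⟨ψ, hψ, hψg⟩ := exists_dirichletCharacter_jacobiSym_right m hk hsf
      obtain ⟨φ, hφ, hφg⟩ := DirichletCharacter.exists_mul_of_coprime hc
        (ZMod.χ₄.ringHomComp (Int.castRingHom ℂ)) ψ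
      refine ⟨φ, fun n hn ↦ ?_, ?_⟩
      · rw [hφ, hψ, MulChar.ringHomComp_apply, Nat.cast_mul, jacobiSym.mul_left,
          show ((4 : ℕ) : ℤ) = 4 by norm_num, jacobiSym.at_four hn]
        rcases (by have := Nat.odd_iff.mp hn; omega : n % 4 = 1 ∨ n % 4 = 3) with hn4 | hn4
        · rw [jacobiSym.quadratic_reciprocity_one_mod_four' hk hn4, ZMod.χ₄_nat_one_mod_four hn4]
          simp
        · rw [jacobiSym.quadratic_reciprocity_three_mod_four hm hn4,
            ZMod.χ₄_nat_three_mod_four hn4]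
          simp
      · have hsqrt : (√(4 * m : ℕ) : ℝ) = 2 * √m := by
          rw [show ((4 * m : ℕ) : ℝ) = 2 ^ 2 * m by push_cast; ring, Real.sqrt_mul (by positivity),
            Real.sqrt_sq (by norm_num)]
        rw [show gaussSum φ ZMod.stdAddChar = _ from hφg, hψ, hψg, gaussSum_χ₄, hsqrt,
          show ((4 : ℕ) : ℤ) = 4 by norm_num, jacobiSym.at_four hk,
          gaussSign, if_neg (by omega), MulChar.ringHomComp_apply, eq_intCast, ZMod.χ₄_nat_three_mod_four hm]
        push_cast
        linear_combination (-2 * (√m : ℝ) : ℂ) * Complex.I_sq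

end Character

section NormSum

variable {p : ℕ} [Fact p.Prime]

theorem ZMod.sum_comp_mul_left {a : ZMod p} (ha : a ≠ 0) (f : ZMod p → ℂ) :
    ∑ x, f (a * x) = ∑ x, f x :=
  Equiv.sum_comp (Equiv.mulLeft₀ a ha) f

theorem ZMod.sum_comp_sq (hp : p ≠ 2) (f : ZMod p → ℂ) :
    ∑ u, f (u ^ 2) = ∑ v, ((quadraticChar (ZMod p) v : ℂ) + 1) * f v := by
  have hchar : ringChar (ZMod p) ≠ 2 := by rwa [ZMod.ringChar_zmod_n]
  rw [← Finset.sum_fiberwise (s := Finset.univ) (g := fun u : ZMod p ↦ u ^ 2)]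
  refine Finset.sum_congr rfl fun v _ ↦ ?_
  have h := quadraticChar_card_sqrts hchar v
  have h' : ({x : ZMod p | x ^ 2 = v} : Set (ZMod p)).toFinset =
      Finset.univ.filter fun u : ZMod p ↦ u ^ 2 = v := by ext; simp
  rw [h'] at h
  have hC : ((Finset.univ.filter fun u : ZMod p ↦ u ^ 2 = v).card : ℂ) =
      (quadraticChar (ZMod p) v : ℂ) + 1 := by exact_mod_cast h
  rw [← hC, ← nsmul_eq_mul]
  refine Finset.sum_eq_card_nsmul fun u hu ↦ ?_
  rw [(Finset.mem_filter.mp hu).2]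

theorem ZMod.sum_comp_sq_add_sum_comp_mul_sq (hp : p ≠ 2) (f : ZMod p → ℂ) {d : ZMod p}
    (hd : quadraticChar (ZMod p) d = -1) :
    ∑ u, f (u ^ 2) + ∑ u, f (d * u ^ 2) = 2 * ∑ v, f v := by
  have hd0 : d ≠ 0 := by
    rintro rfl
    simp at hd
  rw [ZMod.sum_comp_sq hp, ZMod.sum_comp_sq hp fun v ↦ f (d * v)]
  rw [← ZMod.sum_comp_mul_left hd0 fun v ↦ ((quadraticChar (ZMod p) v : ℂ) + 1) * f v,
    ← ZMod.sum_comp_mul_left hd0 f, Finset.mul_sum, ← Finset.sum_add_distrib]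
  refine Finset.sum_congr rfl fun v _ ↦ ?_
  simp only [map_mul, hd]
  push_cast
  ring

theorem DirichletCharacter.mul_gaussSum_sq (hp : p ≠ 2) (σ : DirichletCharacter ℂ p) :
    σ 4 * gaussSum σ ZMod.stdAddChar ^ 2 =
      ∑ t, ∑ u, σ (t ^ 2 - u ^ 2) * ZMod.stdAddChar t := by
  have h2 : (2 : ZMod p) ≠ 0 := Ring.two_ne_zero (by rwa [ZMod.ringChar_zmod_n])
  have hinj : Function.Injective fun x : ZMod p × ZMod p ↦ (x.1 + x.2, x.1 - x.2) := by
    intro x y hxy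
    simp only [Prod.mk.injEq] at hxy
    refine Prod.ext (mul_left_cancel₀ h2 ?_) (mul_left_cancel₀ h2 ?_)
    · linear_combination hxy.1 + hxy.2
    · linear_combination hxy.1 - hxy.2
  rw [sq, gaussSum, Fintype.sum_mul_sum, ← Fintype.sum_prod_type', Finset.mul_sum,
    ← Fintype.sum_prod_type']
  refine Fintype.sum_equiv (Equiv.ofBijective _ (Finite.injective_iff_bijective.mp hinj)) _ _
    fun x ↦ ?_
  rw [Equiv.ofBijective_apply]
  dsimp only
  rw [AddChar.map_add_eq_mul, show (x.1 + x.2) ^ 2 - (x.1 - x.2) ^ 2 = 4 * (x.1 * x.2) by ring,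
    map_mul, map_mul]
  ring

theorem DirichletCharacter.sum_sq_sub_mul_sq (hp : p ≠ 2) {σ : DirichletCharacter ℂ p} (hσ : σ ≠ 1)
    {d : ZMod p} (hd : d ≠ 0) :
    ∑ b, ∑ u, σ (u ^ 2 - d * b ^ 2) * ZMod.stdAddChar b =
      σ (-1) * σ d * quadraticChar (ZMod p) d *
        ∑ t, ∑ u, σ (t ^ 2 - u ^ 2) * ZMod.stdAddChar t := by
  rcases quadraticChar_dichotomy hd with h1 | h1
  · obtain ⟨s, rfl⟩ := (quadraticChar_one_iff_isSquare hd).mp h1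
    have hs : s ≠ 0 := fun h ↦ hd (by simp [h])
    rw [h1, Finset.mul_sum]
    refine Finset.sum_congr rfl fun b _ ↦ ?_
    rw [← ZMod.sum_comp_mul_left hs, Finset.mul_sum]
    refine Finset.sum_congr rfl fun u _ ↦ ?_
    rw [show (s * u) ^ 2 - s * s * b ^ 2 = (-1) * (s * s) * (b ^ 2 - u ^ 2) by ring, map_mul,
      map_mul]
    push_cast
    ring
  · rw [h1, Finset.mul_sum, ← sub_eq_zero, ← Finset.sum_sub_distrib]
    refine Finset.sum_eq_zero fun b _ ↦ ?_
    have h := ZMod.sum_comp_sq_add_sum_comp_mul_sq hp (fun v ↦ σ (v - d * b ^ 2)) h1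
    have h0 : ∑ v, σ (v - d * b ^ 2) = 0 := by
      exact (Equiv.sum_comp (Equiv.subRight (d * b ^ 2)) σ).trans
        (MulChar.sum_eq_zero_of_ne_one hσ)
    rw [h0, mul_zero] at h
    have h2 : ∑ u, σ (d * u ^ 2 - d * b ^ 2) = σ (-1) * σ d * ∑ u, σ (b ^ 2 - u ^ 2) := by
      rw [Finset.mul_sum]
      refine Finset.sum_congr rfl fun u _ ↦ ?_
      rw [← map_mul, ← map_mul]
      congr 1
      ring
    rw [h2] at h
    rw [← Finset.sum_mul, ← Finset.sum_mul]
    push_cast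
    linear_combination ZMod.stdAddChar b * h

/-- The character sum over the norm form `a² + d a b + b² (d² - d) / 4`. -/
theorem DirichletCharacter.sum_norm_form (hp : p ≠ 2) {σ : DirichletCharacter ℂ p} (hσ : σ ≠ 1)
    {d : ZMod p} (hd : d ≠ 0) (f : ZMod p → ZMod p → ZMod p)
    (hf : ∀ a b, 4 * f a b = (2 * a + b * d) ^ 2 - d * b ^ 2) :
    ∑ b, ∑ a, σ (f a b) * ZMod.stdAddChar b =
      σ (-1) * σ d * quadraticChar (ZMod p) d * gaussSum σ ZMod.stdAddChar ^ 2 := by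
  have h2 : (2 : ZMod p) ≠ 0 := Ring.two_ne_zero (by rwa [ZMod.ringChar_zmod_n])
  have h4 : σ 4 ≠ 0 := by
    rw [show (4 : ZMod p) = 2 * 2 by norm_num]
    exact (((mul_ne_zero h2 h2).isUnit).map σ).ne_zero
  refine mul_left_cancel₀ h4 ?_
  have h : σ 4 * ∑ b, ∑ a, σ (f a b) * ZMod.stdAddChar b =
      ∑ b, ∑ u, σ (u ^ 2 - d * b ^ 2) * ZMod.stdAddChar b := by
    rw [Finset.mul_sum]
    refine Finset.sum_congr rfl fun b _ ↦ ?_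
    rw [← Equiv.sum_comp (Equiv.addRight (b * d))
        fun u ↦ σ (u ^ 2 - d * b ^ 2) * ZMod.stdAddChar b,
      ← ZMod.sum_comp_mul_left h2
        fun a ↦ σ ((Equiv.addRight (b * d) a) ^ 2 - d * b ^ 2) * ZMod.stdAddChar b,
      Finset.mul_sum]
    refine Finset.sum_congr rfl fun a _ ↦ ?_
    rw [← mul_assoc, ← map_mul, hf, Equiv.coe_addRight]
  rw [h, DirichletCharacter.sum_sq_sub_mul_sq hp hσ hd, ← DirichletCharacter.mul_gaussSum_sq hp]
  ring

theorem DirichletCharacter.IsPrimitive.ne_one_of_prime {σ : DirichletCharacter ℂ p}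
    (hσ : σ.IsPrimitive) : σ ≠ 1 := by
  rintro rfl
  have h : (1 : DirichletCharacter ℂ p).conductor = p := hσ
  rw [DirichletCharacter.conductor_one] at h
  exact (Fact.out : p.Prime).ne_one h.symm

theorem DirichletCharacter.IsPrimitive.prime_ne_two {σ : DirichletCharacter ℂ p}
    (hσ : σ.IsPrimitive) : p ≠ 2 := by
  rintro rfl
  refine hσ.ne_one_of_prime (MulChar.ext fun u ↦ ?_)
  rw [Subsingleton.elim u 1]
  simp

end NormSum

theorem RingOfIntegers.exists_coe_eq_of_sq_eq {F : Type*} [Field F] {y : F} {t n : ℤ}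
    (h : y ^ 2 = t * y + n) :
    ∃ x : 𝓞 F, (x : F) = y := by
  refine ⟨⟨y, Polynomial.X ^ 2 - (Polynomial.C t * Polynomial.X + Polynomial.C n), ?_, ?_⟩, rfl⟩
  · exact Polynomial.monic_X_pow_sub (by
      refine lt_of_le_of_lt (by compute_degree : _ ≤ (1 : WithBot ℕ)) ?_
      norm_num)
  · rw [Polynomial.eval₂_sub, Polynomial.eval₂_add, Polynomial.eval₂_mul,
      Polynomial.eval₂_C, Polynomial.eval₂_C, Polynomial.eval₂_X_pow, Polynomial.eval₂_X, h, eq_intCast, eq_intCast, sub_self]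

section QuadraticField

variable {F : Type*} [Field F] [NumberField F]

theorem exists_algEquiv_norm_trace_eq (hF : Module.finrank ℚ F = 2) :
    ∃ τ : F ≃ₐ[ℚ] F, (∀ x, algebraMap ℚ F (Algebra.trace ℚ F x) = x + τ x) ∧
      ∀ x, algebraMap ℚ F (Algebra.norm ℚ x) = x * τ x := by
  classical
  have : Algebra.IsQuadraticExtension ℚ F := { finrank_eq_two' := hF }
  have hcard : Fintype.card (F ≃ₐ[ℚ] F) = 2 := by
    rw [← Nat.card_eq_fintype_card, IsGalois.card_aut_eq_finrank, hF]
  have : Nontrivial (F ≃ₐ[ℚ] F) := Fintype.one_lt_card_iff_nontrivial.mp (by omega)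
  obtain ⟨τ, hτ⟩ := exists_ne (1 : F ≃ₐ[ℚ] F)
  have huniv : (Finset.univ : Finset (F ≃ₐ[ℚ] F)) = {1, τ} := by
    refine (Finset.eq_univ_of_card _ ?_).symm
    rw [Finset.card_pair hτ.symm, hcard]
  refine ⟨τ, fun x ↦ ?_, fun x ↦ ?_⟩
  · rw [trace_eq_sum_automorphisms, huniv, Finset.sum_pair hτ.symm, AlgEquiv.one_apply]
  · rw [Algebra.norm_eq_prod_automorphisms, huniv, Finset.prod_pair hτ.symm, AlgEquiv.one_apply]

theorem exists_conj_sub_mul_conj (hF : Module.finrank ℚ F = 2) {τ : F ≃ₐ[ℚ] F}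
    (hT : ∀ x, algebraMap ℚ F (Algebra.trace ℚ F x) = x + τ x)
    (hN : ∀ x, algebraMap ℚ F (Algebra.norm ℚ x) = x * τ x) {D : ℕ}
    (hdisc : discr F = D) {s : F} (hs : s ^ 2 = D) :
    τ s = -s ∧ (∀ x : 𝓞 F, ∃ b : ℤ, (x : F) - τ x = b * s) ∧ ∃ r n : ℤ, (D : ℤ) = r ^ 2 - 4 * n := by
  classical
  have hT' (x : 𝓞 F) : ((Algebra.trace ℤ (𝓞 F) x : ℤ) : F) = x + τ x := by
    rw [← hT, ← Algebra.coe_trace_int]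
    simp
  have hN' (x : 𝓞 F) : ((Algebra.norm ℤ x : ℤ) : F) = x * τ x := by
    rw [← hN, ← Algebra.coe_norm_int]
    simp
  have hττ (x : F) : τ (τ x) = x := by
    have h := congrArg τ (hT x)
    rw [AlgEquiv.commutes, hT, map_add] at h
    linear_combination -h
  have hrank : Module.finrank ℤ (𝓞 F) = 2 := by rw [RingOfIntegers.rank, hF]
  have e : Module.Free.ChooseBasisIndex ℤ (𝓞 F) ≃ Fin 2 := Fintype.equivFinOfCardEq (by
    rw [← Module.finrank_eq_card_chooseBasisIndex, hrank])
  obtain ⟨b⟩ : Nonempty (Module.Basis (Fin 2) ℤ (𝓞 F)) := ⟨(RingOfIntegers.basis F).reindex e⟩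
  have hdet : ((b 0 : F) * τ (b 1) - b 1 * τ (b 0)) ^ 2 = D := by
    have h := discr_eq_discr F b
    rw [hdisc, Algebra.discr_def, Matrix.det_fin_two] at h
    have h' := congrArg (Int.cast : ℤ → F) h
    simp only [Algebra.traceMatrix_apply, Algebra.traceForm_apply] at h'
    push_cast [hT', map_mul] at h'
    linear_combination h'
  have hrel (x : 𝓞 F) : ∃ k : ℤ, (x : F) - τ x = k * ((b 0 : F) * τ (b 1) - b 1 * τ (b 0)) := by
    have hcoord (y : 𝓞 F) : (y : F) = b.repr y 0 * b 0 + b.repr y 1 * b 1 := by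
      have h := congrArg (algebraMap (𝓞 F) F) (b.sum_repr y)
      rw [Fin.sum_univ_two] at h
      simpa using h.symm
    refine ⟨b.repr x 0 * b.repr 1 1 - b.repr x 1 * b.repr 1 0, ?_⟩
    have h1 := hcoord 1
    have h1' := congrArg τ h1
    have hx := hcoord x
    have hx' := congrArg τ hx
    simp only [map_one, map_add, map_mul, map_intCast] at h1 h1' hx'
    push_cast
    linear_combination (x : F) * h1' - τ x * h1 +
      (b.repr 1 0 * τ (b 0) + b.repr 1 1 * τ (b 1)) * hx -
      (b.repr 1 0 * (b 0 : F) + b.repr 1 1 * (b 1 : F)) * hx'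
  have hcases : s = (b 0 : F) * τ (b 1) - b 1 * τ (b 0) ∨
      s = -((b 0 : F) * τ (b 1) - b 1 * τ (b 0)) := sq_eq_sq_iff_eq_or_eq_neg.mp (hs.trans hdet.symm)
  refine ⟨?_, fun x ↦ ?_, Algebra.trace ℤ (𝓞 F) (b 0) * Algebra.trace ℤ (𝓞 F) (b 1) -
    Algebra.trace ℤ (𝓞 F) (b 0 * b 1), Algebra.norm ℤ (b 0) * Algebra.norm ℤ (b 1), ?_⟩
  · rcases hcases with h | h <;>
    · rw [h]
      simp only [map_neg, map_sub, map_mul, hττ]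
      ring
  · obtain ⟨k, hk⟩ := hrel x
    rcases hcases with h | h
    · exact ⟨k, by rw [hk, h]⟩
    · exact ⟨-k, by rw [hk, h]; push_cast; ring⟩
  · refine Int.cast_injective (α := F) ?_
    push_cast [hT', hN', map_mul]
    linear_combination -hdet

/-- The ring of integers of a quadratic field of discriminant `D` has basis
`1, ω = (D + √D) / 2`. -/
structure IsQuadraticBasis (D : ℕ) (s ω : 𝓞 F) (c : ℤ) : Prop where
  four_mul : 4 * c = (D : ℤ) ^ 2 - D
  two_mul : 2 * ω = D + s
  exists_eq (x : 𝓞 F) : ∃ a b : ℤ, x = a + b * ω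
  norm_eq (a b : ℤ) : Algebra.norm ℤ ((a : 𝓞 F) + b * ω) = a ^ 2 + a * b * D + b ^ 2 * c
  trace_eq (a b : ℤ) : Algebra.trace ℚ F (((a : 𝓞 F) + b * ω : 𝓞 F) / s) = b
  norm_sqrt : Algebra.norm ℤ s = -D

theorem exists_isQuadraticBasis (hF : Module.finrank ℚ F = 2) {D : ℕ} (hD : D ≠ 0)
    (hdisc : discr F = D) {s : 𝓞 F} (hs : (s : F) ^ 2 = D) : ∃ ω c, IsQuadraticBasis D s ω c := by
  obtain ⟨τ, hT, hN⟩ := exists_algEquiv_norm_trace_eq hF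
  obtain ⟨hτs, hsub, r, n, hrn⟩ := exists_conj_sub_mul_conj hF hT hN hdisc hs
  have hs0 : (s : F) ≠ 0 := by
    intro h
    rw [h, zero_pow two_ne_zero] at hs
    exact hD (by exact_mod_cast hs.symm)
  obtain ⟨c, hc⟩ : ∃ c : ℤ, 4 * c = (D : ℤ) ^ 2 - D := by
    have h4 : (4 : ℤ) ∣ r ^ 2 * (r ^ 2 - 1) := by
      rcases Int.even_or_odd' r with ⟨k, rfl | rfl⟩
      · exact ⟨k ^ 2 * ((2 * k) ^ 2 - 1), by ring⟩
      · exact ⟨(2 * k + 1) ^ 2 * (k ^ 2 + k), by ring⟩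
    obtain ⟨k, hk⟩ := h4
    refine ⟨k + 4 * n ^ 2 - 2 * r ^ 2 * n + n, ?_⟩
    rw [hrn]
    linear_combination -hk
  have hcF : (4 * c : F) = (D : F) ^ 2 - D := by exact_mod_cast congrArg (Int.cast : ℤ → F) hc
  obtain ⟨ω, hω⟩ := RingOfIntegers.exists_coe_eq_of_sq_eq (y := ((D : F) + s) / 2)
    (t := D) (n := -c) (by push_cast; linear_combination hs / 4 + hcF / 4)
  have hω2 : 2 * (ω : F) = D + s := by rw [hω]; ring
  have hτω : 2 * τ ω = D - s := by
    have h := congrArg τ hω2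
    simp only [map_mul, map_ofNat, map_add, map_natCast, hτs] at h
    linear_combination h
  refine ⟨ω, c, hc, ?_, fun x ↦ ?_, fun a b ↦ ?_, fun a b ↦ ?_, ?_⟩
  · exact RingOfIntegers.ext (by simp only [map_mul, map_add, map_natCast, map_ofNat]; exact hω2)
  · obtain ⟨b, hb⟩ := hsub x
    have hfix : τ (x - b * ω : F) = x - b * ω := by
      simp only [map_sub, map_mul, map_intCast]
      linear_combination -hb + b * hω2 / 2 - b * hτω / 2
    have hq : algebraMap ℚ F (Algebra.trace ℚ F (x - b * ω : F) / 2) = (x - b * ω : F) := by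
      rw [map_div₀, hT, hfix, map_ofNat]
      ring
    have hint : IsIntegral ℤ (Algebra.trace ℚ F (x - b * ω : F) / 2) := by
      rw [← isIntegral_algebraMap_iff (algebraMap ℚ F).injective, hq]
      exact_mod_cast (x - b * ω).isIntegral_coe
    obtain ⟨a, ha⟩ := IsIntegrallyClosed.isIntegral_iff.mp hint
    refine ⟨a, b, RingOfIntegers.ext ?_⟩
    rw [← ha] at hq
    simp only [eq_intCast, map_intCast] at hq
    simp only [map_add, map_mul, map_intCast]
    linear_combination -hq
  · apply Int.cast_injective (α := ℚ)
    rw [Algebra.coe_norm_int]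
    apply (algebraMap ℚ F).injective
    rw [hN]
    push_cast
    simp only [map_add, map_mul, map_intCast]
    linear_combination (exp := 1) (a * b * (hω2 + hτω) / 2) +
      b ^ 2 * (hω2 * τ ω / 2 + (D + s) / 4 * hτω - hs / 4 - hcF / 4)
  · apply (algebraMap ℚ F).injective
    rw [hT, map_div₀, hτs, map_intCast]
    push_cast
    simp only [map_add, map_mul, map_intCast]
    field_simp
    linear_combination b * (hω2 - hτω) / 2
  · apply Int.cast_injective (α := ℚ)
    rw [Algebra.coe_norm_int]
    apply (algebraMap ℚ F).injective
    rw [hN, hτs]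
    push_cast
    linear_combination -hs

end QuadraticField

namespace IsQuadraticBasis

variable {F : Type*} [Field F] [NumberField F] {D : ℕ} {s ω : 𝓞 F} {c : ℤ}

theorem ne_zero (h : IsQuadraticBasis D s ω c) (hD : D ≠ 0) : s ≠ 0 := by
  rintro rfl
  have := h.norm_sqrt
  rw [Algebra.norm_zero] at this
  omega

theorem dvd_two_mul (h : IsQuadraticBasis D s ω c) {x : 𝓞 F} {k e l : ℤ}
    (hx : k * x = e + l * s) : k ∣ 2 * l := by
  obtain ⟨a, b, rfl⟩ := h.exists_eq x
  have h1 : ((k * a : ℤ) : 𝓞 F) + (k * b : ℤ) * ω = ((e - l * D : ℤ) : 𝓞 F) + (2 * l : ℤ) * ω := by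
    push_cast
    linear_combination hx - l * h.two_mul
  have h2 := congrArg (fun y : 𝓞 F ↦ Algebra.trace ℚ F ((y : F) / s)) h1
  simp only [h.trace_eq] at h2
  exact ⟨b, by exact_mod_cast h2.symm⟩

theorem differentIdeal_eq (h : IsQuadraticBasis D s ω c) (hD : D ≠ 0) (hdisc : discr F = D) :
    differentIdeal ℤ (𝓞 F) = Ideal.span {s} := by
  have hs := h.ne_zero hD
  have hbot : Ideal.span {s} ≠ ⊥ := by simpa using hs
  have hle : differentIdeal ℤ (𝓞 F) ≤ Ideal.span {s} := by
    rw [differentialIdeal_le_iff (K := ℚ) (L := F) hbot, Submodule.map_le_iff_le_comap]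
    intro y hy
    simp only [Submodule.restrictScalars_mem, FractionalIdeal.mem_coe] at hy
    rw [FractionalIdeal.coeIdeal_span_singleton, FractionalIdeal.spanSingleton_inv,
      FractionalIdeal.mem_spanSingleton] at hy
    obtain ⟨x, rfl⟩ := hy
    obtain ⟨a, b, rfl⟩ := h.exists_eq x
    refine ⟨b, ?_⟩
    have := h.trace_eq a b
    rw [LinearMap.restrictScalars_apply, Algebra.smul_def, ← div_eq_mul_inv]
    rw [LinearMap.toSpanSingleton_apply, zsmul_one]
    exact this.symm
  obtain ⟨J, hJ⟩ := Ideal.dvd_iff_le.mpr hle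
  have hn := congrArg Ideal.absNorm hJ
  rw [map_mul, absNorm_differentIdeal F, hdisc, Ideal.absNorm_span_singleton, h.norm_sqrt,
    Int.natAbs_neg, Int.natAbs_natCast] at hn
  have hJ1 : Ideal.absNorm J = 1 := by
    refine mul_left_cancel₀ hD ?_
    rw [mul_one, ← hn]
  rw [hJ, Ideal.absNorm_eq_one_iff.mp hJ1, Ideal.mul_top]

theorem isPosFundamental (h : IsQuadraticBasis D s ω c) (hs : (s : F) ^ 2 = D) :
    IsPosFundamental D := by
  have hdvd {y : F} {t n : ℤ} (hy : y ^ 2 = t * y + n) {k e : ℤ} (hk : k * y = e + s) : k ∣ 2 := by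
    obtain ⟨x, rfl⟩ := RingOfIntegers.exists_coe_eq_of_sq_eq hy
    refine mul_one (2 : ℤ) ▸ h.dvd_two_mul (x := x) (e := e) (RingOfIntegers.ext ?_)
    simpa using hk
  have hmod : D % 4 = 1 ∨ D % 4 = 0 := by
    have h4 := h.four_mul
    have : (D : ZMod 4) ^ 2 - D = 0 := by
      have := congrArg (Int.cast : ℤ → ZMod 4) h4
      push_cast at this
      rw [← this, show (4 : ZMod 4) = 0 from rfl, zero_mul]
    have key : ∀ a : ZMod 4, a ^ 2 - a = 0 → a = 1 ∨ a = 0 := by decide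
    rcases key _ this with h1 | h0
    · exact Or.inl ((ZMod.natCast_eq_natCast_iff' D 1 4).mp (by simpa using h1))
    · exact Or.inr ((ZMod.natCast_eq_natCast_iff' D 0 4).mp (by simpa using h0))
  rcases hmod with h1 | h0
  · refine Or.inl ⟨h1, Nat.squarefree_iff_prime_squarefree.mpr fun r hr ⟨k, hk⟩ ↦ ?_⟩
    have hr0 : (r : F) ≠ 0 := by exact_mod_cast hr.ne_zero
    have hr2 : (r : ℤ) ∣ 2 := hdvd (y := s / r) (t := 0) (n := k) (e := 0)
      (by rw [div_pow, hs, hk]; push_cast; field_simp; ring) (by push_cast; field_simp; ring)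
    rw [(Nat.prime_dvd_prime_iff_eq hr Nat.prime_two).mp (by exact_mod_cast hr2)] at hk
    omega
  · obtain ⟨m, rfl⟩ := Nat.dvd_of_mod_eq_zero h0
    have hsq : Squarefree m := Nat.squarefree_iff_prime_squarefree.mpr fun r hr ⟨k, hk⟩ ↦ by
      have hr0 : (r : F) ≠ 0 := by exact_mod_cast hr.ne_zero
      have hr2 : (2 * r : ℤ) ∣ 2 := hdvd (y := s / (2 * r)) (t := 0) (n := k) (e := 0)
        (by rw [div_pow, hs, hk]; push_cast; field_simp; ring) (by push_cast; field_simp; ring)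
      have := Int.le_of_dvd two_pos hr2
      have := hr.two_le
      omega
    refine Or.inr ⟨m, rfl, hsq, ?_⟩
    have hm0 : m % 4 ≠ 0 := fun h0 ↦ by
      obtain ⟨k, rfl⟩ := Nat.dvd_of_mod_eq_zero h0
      have := Nat.isUnit_iff.mp (hsq 2 ⟨k, by ring⟩)
      omega
    have hm1 : m % 4 ≠ 1 := fun h1 ↦ by
      obtain ⟨k, rfl⟩ : ∃ k, m = 4 * k + 1 := ⟨m / 4, by omega⟩
      have : (4 : ℤ) ∣ 2 := hdvd (y := (2 + s) / 4) (t := 1) (n := k) (e := 2)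
        (by push_cast at hs ⊢; linear_combination hs / 16) (by push_cast; ring)
      omega
    omega

theorem not_isSquare_of_isPrime (h : IsQuadraticBasis D s ω c) (hs : s ^ 2 = D) {q : ℕ}
    (hq2 : ¬ (q : ℤ) ∣ 2) (hq : (Ideal.span {(q : 𝓞 F)}).IsPrime) : ¬ IsSquare (D : ZMod q) := by
  rintro ⟨t, ht⟩
  obtain ⟨t, rfl⟩ := ZMod.intCast_surjective t
  obtain ⟨k, hk⟩ : (q : ℤ) ∣ D - t * t := by
    rw [← ZMod.intCast_zmod_eq_zero_iff_dvd]
    push_cast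
    rw [ht, sub_self]
  have hmem : (s - t) * (s + t) ∈ Ideal.span {(q : 𝓞 F)} := by
    refine Ideal.mem_span_singleton.mpr ⟨k, ?_⟩
    have hk' := congrArg (Int.cast : ℤ → 𝓞 F) hk
    push_cast at hk'
    linear_combination hk' + hs
  rcases hq.mem_or_mem hmem with hm | hm <;> obtain ⟨x, hx⟩ := Ideal.mem_span_singleton.mp hm
  · exact hq2 (mul_one (2 : ℤ) ▸ h.dvd_two_mul (x := x) (e := -t)
      (by push_cast; linear_combination -hx))
  · exact hq2 (mul_one (2 : ℤ) ▸ h.dvd_two_mul (x := x) (e := t)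
      (by push_cast; linear_combination -hx))

theorem isPrime_of_not_isSquare (h : IsQuadraticBasis D s ω c) {q : ℕ} (hq : q.Prime)
    (hq2 : ¬ (q : ℤ) ∣ 2) (hD : ¬ IsSquare (D : ZMod q)) : (Ideal.span {(q : 𝓞 F)}).IsPrime := by
  have := Fact.mk hq
  have hqp : Prime (q : ℤ) := Nat.prime_iff_prime_int.mp hq
  have hmem {x : 𝓞 F} (hx : (q : ℤ) ∣ Algebra.norm ℤ x) : x ∈ Ideal.span {(q : 𝓞 F)} := by
    obtain ⟨a, b, rfl⟩ := h.exists_eq x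
    rw [h.norm_eq] at hx
    have hform : (q : ℤ) ∣ (2 * a + b * D) ^ 2 - D * b ^ 2 := by
      obtain ⟨k, hk⟩ := hx
      exact ⟨4 * k, by linear_combination 4 * hk - b ^ 2 * h.four_mul⟩
    have hb : (q : ℤ) ∣ b := by
      by_contra hb
      have hb0 : (b : ZMod q) ≠ 0 := by rwa [ne_eq, ZMod.intCast_zmod_eq_zero_iff_dvd]
      refine hD ⟨(2 * a + b * D) / b, ?_⟩
      have h0 := (ZMod.intCast_zmod_eq_zero_iff_dvd _ q).mpr hform
      push_cast at h0
      field_simp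
      linear_combination -h0
    obtain ⟨b, rfl⟩ := hb
    have ha : (q : ℤ) ∣ 2 * a := by
      have h1 : (q : ℤ) ∣ (2 * a + q * b * D) ^ 2 :=
        (dvd_sub_left ⟨D * (q * b ^ 2), by ring⟩).mp hform
      exact (dvd_add_left ⟨b * D, by ring⟩).mp (hqp.dvd_of_dvd_pow h1)
    obtain ⟨a, rfl⟩ := (hqp.dvd_or_dvd ha).resolve_left hq2
    refine Ideal.mem_span_singleton.mpr ⟨a + b * ω, ?_⟩
    push_cast
    ring
  refine ⟨fun htop ↦ ?_, fun {x y} hxy ↦ ?_⟩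
  · obtain ⟨x, hx⟩ := Ideal.mem_span_singleton.mp ((Ideal.eq_top_iff_one _).mp htop)
    exact hq2 (mul_one (2 : ℤ) ▸ h.dvd_two_mul (x := x * s) (e := 0)
      (by push_cast; linear_combination -s * hx))
  · obtain ⟨z, hz⟩ := Ideal.mem_span_singleton.mp hxy
    have hn := congrArg (Algebra.norm ℤ) hz
    have hnq := h.norm_eq q 0
    simp only [Int.cast_natCast, Int.cast_zero, zero_mul, add_zero, mul_zero] at hnq
    rw [map_mul, map_mul, hnq] at hn
    have : (q : ℤ) ∣ Algebra.norm ℤ x * Algebra.norm ℤ y := by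
      rw [hn]
      exact ⟨q * Algebra.norm ℤ z, by ring⟩
    exact (hqp.dvd_or_dvd this).imp hmem hmem

end IsQuadraticBasis

section CharacterDeterminedByOdd
open scoped NumberTheorySymbols

theorem MulChar.ext_of_odd {D : ℕ} [NeZero D] {χ ψ : DirichletCharacter ℂ D}
    (h : ∀ n : ℕ, Odd n → χ n = ψ n) : χ = ψ := by
  refine MulChar.ext fun u ↦ ?_
  have hcop : ((u : ZMod D).val).Coprime D := ZMod.val_coe_unit_coprime u
  rcases Nat.even_or_odd (u : ZMod D).val with hu | hu
  · have hD : Odd D := by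
      rw [← Nat.not_even_iff_odd]
      intro hD
      have := Nat.dvd_gcd hu.two_dvd hD.two_dvd
      rw [hcop.gcd_eq_one] at this
      omega
    simpa using h _ (hu.add_odd hD)
  · simpa using h _ hu

theorem MulChar.eq_jacobiSym_of_prime {D : ℕ} {χ : DirichletCharacter ℂ D}
    (h : ∀ q : ℕ, q.Prime → q ≠ 2 → χ q = J(D | q)) (n : ℕ) (hn : Odd n) : χ n = J(D | n) := by
  induction n using Nat.recOnMul with
  | zero => simp at hn
  | one => simp
  | prime q hq => exact h q hq (by rintro rfl; exact absurd hn (by decide))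
  | mul a b ha hb =>
    obtain ⟨hoa, hob⟩ := Nat.odd_mul.mp hn
    rw [Nat.cast_mul, map_mul, ha hoa, hb hob, jacobiSym.mul_right' _ hoa.pos.ne' hob.pos.ne']
    push_cast
    rfl

theorem jacobiSym_natCast_of_prime {D q : ℕ} [Fact q.Prime] :
    J(D | q) = quadraticChar (ZMod q) D := by
  rw [← jacobiSym.legendreSym.to_jacobiSym, legendreSym, Int.cast_natCast]

end CharacterDeterminedByOdd

namespace IsQuadraticBasis

variable {F : Type*} [Field F] [NumberField F] {D : ℕ} {s ω : 𝓞 F} {c : ℤ}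

theorem apply_eq_quadraticChar (h : IsQuadraticBasis D s ω c) (hs : s ^ 2 = D)
    {χ : DirichletCharacter ℂ D}
    (hχ : ∀ q : ℕ, q.Prime → ¬ q ∣ D →
      ((Ideal.span {(q : 𝓞 F)}).IsPrime → χ (q : ZMod D) = -1) ∧
      (¬ (Ideal.span {(q : 𝓞 F)}).IsPrime → χ (q : ZMod D) = 1))
    {q : ℕ} [hq : Fact q.Prime] (hq2 : q ≠ 2) : χ q = quadraticChar (ZMod q) D := by
  have hq2' : ¬ (q : ℤ) ∣ 2 := by
    intro h2
    exact hq2 ((Nat.prime_dvd_prime_iff_eq hq.out Nat.prime_two).mp (by exact_mod_cast h2))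
  by_cases hqD : q ∣ D
  · rw [(ZMod.natCast_eq_zero_iff D q).mpr hqD, MulChar.map_zero, Int.cast_zero]
    refine MulChar.map_nonunit _ fun hu ↦ hq.out.ne_one ?_
    exact Nat.dvd_one.mp ((ZMod.isUnit_iff_coprime q D).mp hu ▸ Nat.dvd_gcd dvd_rfl hqD)
  · have hD0 : (D : ZMod q) ≠ 0 := by rwa [ne_eq, ZMod.natCast_eq_zero_iff]
    by_cases hsq : IsSquare (D : ZMod q)
    · rw [(quadraticChar_one_iff_isSquare hD0).mpr hsq,
        (hχ q hq.out hqD).2 fun hp ↦ h.not_isSquare_of_isPrime hs hq2' hp hsq, Int.cast_one]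
    · rw [quadraticChar_neg_one_iff_not_isSquare.mpr hsq,
        (hχ q hq.out hqD).1 (h.isPrime_of_not_isSquare hq.out hq2' hsq), Int.cast_neg, Int.cast_one]

theorem gaussSum_eq_sqrt [NeZero D] (h : IsQuadraticBasis D s ω c) (hs : s ^ 2 = D)
    {χ : DirichletCharacter ℂ D}
    (hχ : ∀ q : ℕ, q.Prime → ¬ q ∣ D →
      ((Ideal.span {(q : 𝓞 F)}).IsPrime → χ (q : ZMod D) = -1) ∧
      (¬ (Ideal.span {(q : 𝓞 F)}).IsPrime → χ (q : ZMod D) = 1)) :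
    gaussSum χ ZMod.stdAddChar = (√D : ℝ) := by
  obtain ⟨ψ, hψ, hg⟩ := exists_dirichletCharacter_jacobiSym_left D
    (h.isPosFundamental (by exact_mod_cast congrArg (algebraMap (𝓞 F) F) hs))
  rw [← hg]
  congr 1
  refine MulChar.ext_of_odd fun n hn ↦ ?_
  rw [hψ n hn]
  refine MulChar.eq_jacobiSym_of_prime (fun q hq hq2 ↦ ?_) n hn
  have := Fact.mk hq
  rw [h.apply_eq_quadraticChar hs hχ hq2, jacobiSym_natCast_of_prime]

theorem dvd_and_dvd (h : IsQuadraticBasis D s ω c) {x : 𝓞 F} {k a b : ℤ}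
    (hx : (a : 𝓞 F) + b * ω = k * x) : k ∣ a ∧ k ∣ b := by
  obtain ⟨a', b', rfl⟩ := h.exists_eq x
  have h1 : (a : 𝓞 F) + b * ω = (k * a' : ℤ) + (k * b' : ℤ) * ω := by
    push_cast
    linear_combination hx
  have h2 := congrArg (fun y : 𝓞 F ↦ Algebra.trace ℚ F ((y : F) / s)) h1
  simp only [h.trace_eq, Int.cast_inj] at h2
  rw [h2, add_left_inj, Int.cast_inj] at h1
  exact ⟨⟨a', h1⟩, ⟨b', h2⟩⟩

theorem bijective_mk (h : IsQuadraticBasis D s ω c) (p : ℕ) [NeZero p] :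
    Function.Bijective fun x : ZMod p × ZMod p ↦
      Ideal.Quotient.mk (Ideal.span {(p : 𝓞 F)}) ((x.1.val : ℤ) + (x.2.val : ℤ) * ω) := by
  constructor
  · rintro ⟨a, b⟩ ⟨a', b'⟩ hab
    obtain ⟨x, hx⟩ := Ideal.mem_span_singleton.mp (Ideal.Quotient.eq.mp hab)
    obtain ⟨ha, hb⟩ := h.dvd_and_dvd (x := x) (k := p) (a := a.val - a'.val) (b := b.val - b'.val)
      (by push_cast at hx ⊢; linear_combination hx)
    rw [← ZMod.intCast_zmod_eq_zero_iff_dvd] at ha hb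
    push_cast at ha hb
    simp only [ZMod.natCast_val, ZMod.cast_id', id_eq, sub_eq_zero] at ha hb
    rw [ha, hb]
  · intro y
    obtain ⟨x, rfl⟩ := Ideal.Quotient.mk_surjective y
    obtain ⟨a, b, rfl⟩ := h.exists_eq x
    refine ⟨(a, b), Ideal.Quotient.eq.mpr (Ideal.mem_span_singleton.mpr ?_)⟩
    have hval (n : ℤ) : ∃ k : ℤ, (((n : ZMod p).val : ℤ)) - n = p * k := by
      refine (ZMod.intCast_zmod_eq_zero_iff_dvd _ p).mp ?_
      push_cast
      simp
    obtain ⟨k, hk⟩ := hval a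
    obtain ⟨l, hl⟩ := hval b
    refine ⟨k + l * ω, ?_⟩
    have hk' := congrArg (Int.cast : ℤ → 𝓞 F) hk
    have hl' := congrArg (Int.cast : ℤ → 𝓞 F) hl
    push_cast at hk' hl' ⊢
    linear_combination hk' + ω * hl'

theorem finsum_eq (h : IsQuadraticBasis D s ω c) {p : ℕ} [NeZero p]
    (σ : DirichletCharacter ℂ p) {g : 𝓞 F ⧸ (Ideal.span {(p : 𝓞 F)}) → ℂ}
    (hg : ∀ x : 𝓞 F, g (Ideal.Quotient.mk (Ideal.span {(p : 𝓞 F)}) x) =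
      σ (((Algebra.norm ℤ x : ℤ)) : ZMod p) *
        Complex.exp (2 * π * Complex.I *
          ((Algebra.trace ℚ F ((algebraMap (𝓞 F) F x) /
            ((p : F) * algebraMap (𝓞 F) F s)) : ℚ) : ℂ))) :
    ∑ᶠ y, g y = ∑ b : ZMod p, ∑ a : ZMod p,
      σ (a ^ 2 + a * b * (D : ZMod p) + b ^ 2 * (c : ZMod p)) * ZMod.stdAddChar b := by
  rw [← finsum_eq_of_bijective _ (h.bijective_mk p) fun _ ↦ rfl, finsum_eq_sum_of_fintype,
    Fintype.sum_prod_type_right]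
  refine Finset.sum_congr rfl fun b _ ↦ Finset.sum_congr rfl fun a _ ↦ ?_
  rw [hg, h.norm_eq]
  have htr : Algebra.trace ℚ F (algebraMap (𝓞 F) F ((a.val : ℤ) + (b.val : ℤ) * ω) /
      ((p : F) * algebraMap (𝓞 F) F s)) = b.val / p := by
    have hsmul (x : F) : x / (p * algebraMap (𝓞 F) F s) =
        (p : ℚ)⁻¹ • (x / algebraMap (𝓞 F) F s) := by
      rw [Algebra.smul_def, map_inv₀, map_natCast, ← div_div, div_right_comm, div_eq_inv_mul]
    rw [hsmul, map_smul, h.trace_eq a.val b.val]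
    simp [div_eq_inv_mul]
  have hb : ZMod.stdAddChar b = Complex.exp (2 * π * Complex.I * b.val / p) := by
    rw [← ZMod.stdAddChar_natCast, ZMod.natCast_zmod_val]
  rw [htr, hb]
  congr 2
  · push_cast
    simp
  · push_cast
    ring

end IsQuadraticBasis

theorem finsum_eq_gaussSum {N : ℕ} [NeZero N] (χ : DirichletCharacter ℂ N) :
    ∑ᶠ a : ZMod N, χ a * Complex.exp (2 * π * Complex.I * (a.val : ℂ) / (N : ℂ)) =
      gaussSum χ ZMod.stdAddChar := by
  rw [finsum_eq_sum_of_fintype]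
  refine Finset.sum_congr rfl fun a _ ↦ ?_
  rw [← ZMod.stdAddChar_natCast, ZMod.natCast_zmod_val]

theorem gaussSum_mul_eq {m n : ℕ} [NeZero m] [NeZero n] (h : m.Coprime n)
    (χ : DirichletCharacter ℂ m) (ψ : DirichletCharacter ℂ n) :
    ∑ᶠ a : ZMod (m * n), χ ((a.val : ℕ) : ZMod m) * ψ ((a.val : ℕ) : ZMod n) *
        Complex.exp (2 * π * Complex.I * (a.val : ℂ) / ((m : ℂ) * (n : ℂ))) =
      χ n * ψ m * gaussSum χ ZMod.stdAddChar * gaussSum ψ ZMod.stdAddChar := by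
  rw [finsum_eq_sum_of_fintype]
  have hsum := ZMod.sum_mul_stdAddChar_of_coprime h χ ψ
  simp only [map_mul] at hsum
  have e1 : ∑ a, χ a * χ n * ZMod.stdAddChar a = χ n * gaussSum χ ZMod.stdAddChar := by
    rw [gaussSum, Finset.mul_sum]
    exact Finset.sum_congr rfl fun a _ ↦ by ring
  have e2 : ∑ b, ψ b * ψ m * ZMod.stdAddChar b = ψ m * gaussSum ψ ZMod.stdAddChar := by
    rw [gaussSum, Finset.mul_sum]
    exact Finset.sum_congr rfl fun a _ ↦ by ring
  rw [e1, e2] at hsum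
  rw [show χ n * ψ m * gaussSum χ ZMod.stdAddChar * gaussSum ψ ZMod.stdAddChar =
    χ n * gaussSum χ ZMod.stdAddChar * (ψ m * gaussSum ψ ZMod.stdAddChar) by ring, ← hsum]
  refine Finset.sum_congr rfl fun a _ ↦ ?_
  rw [← Nat.cast_mul, ← ZMod.stdAddChar_natCast, ZMod.natCast_zmod_val, ZMod.castHom_apply,
    ZMod.castHom_apply, ZMod.natCast_val, ZMod.natCast_val]

/-- Let `F` be a real quadratic field of discriminant `D` embedded in `ℝ`
with `√D ∈ O_F` the positive square root of `D`.  Then the different ideal of `F/ℚ` is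
`(√D)`, and for a primitive Dirichlet character `σ` mod a prime `p ∤ D` with
`σ(−1) = (−1)^δ`,
`(−1)^δ Σ_{x ∈ O_F/p} σ(N(x̃)) e^{2πi Tr(x̃/(p√D))} = D^{−1/2} τ_ℚ(σ) τ_ℚ(σχ_D)
  = σ(D) χ_D(p) τ_ℚ(σ)²`. -/
theorem statement_12
    (F : Type*) [Field F] [NumberField F]
    (hrank : Module.finrank ℚ F = 2)
    (ι : F →+* ℝ)
    (D : ℕ) (hD : 0 < D) (hdisc : NumberField.discr F = (D : ℤ))
    (sqrtD : 𝓞 F) (hsq : (algebraMap (𝓞 F) F sqrtD) ^ 2 = (D : F))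
    (hpos : 0 < ι (algebraMap (𝓞 F) F sqrtD))
    (χD : DirichletCharacter ℂ D)
    (hχD : ∀ q : ℕ, q.Prime → ¬ q ∣ D →
      ((Ideal.span {(q : 𝓞 F)}).IsPrime → χD (q : ZMod D) = -1) ∧
      (¬ (Ideal.span {(q : 𝓞 F)}).IsPrime → χD (q : ZMod D) = 1))
    (p : ℕ) (hp : p.Prime) (hpD : ¬ p ∣ D)
    (σ : DirichletCharacter ℂ p) (hσ : σ.IsPrimitive)
    (δ : ℕ) (hδ : δ = 0 ∨ δ = 1) (hsign : σ (-1) = (-1) ^ δ)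
    -- `g` is the well-defined function `x mod p ↦ σ(N_{F/ℚ}(x))·e^{2πi Tr_{F/ℚ}(x/(p√D))}`
    (g : 𝓞 F ⧸ (Ideal.span {(p : 𝓞 F)}) → ℂ)
    (hg : ∀ x : 𝓞 F, g (Ideal.Quotient.mk (Ideal.span {(p : 𝓞 F)}) x) =
      σ (((Algebra.norm ℤ x : ℤ)) : ZMod p) *
        Complex.exp (2 * π * Complex.I *
          ((Algebra.trace ℚ F ((algebraMap (𝓞 F) F x) /
            ((p : F) * algebraMap (𝓞 F) F sqrtD)) : ℚ) : ℂ))) :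
    differentIdeal ℤ (𝓞 F) = Ideal.span {sqrtD} ∧
    ((-1 : ℂ) ^ δ * ∑ᶠ c : 𝓞 F ⧸ (Ideal.span {(p : 𝓞 F)}), g c) =
      ((Real.sqrt D : ℝ) : ℂ)⁻¹ *
        (∑ᶠ a : ZMod p, σ a * Complex.exp (2 * π * Complex.I * (a.val : ℂ) / (p : ℂ))) *
        (∑ᶠ a : ZMod (p * D), σ ((a.val : ℕ) : ZMod p) * χD ((a.val : ℕ) : ZMod D) *
          Complex.exp (2 * π * Complex.I * (a.val : ℂ) / ((p : ℂ) * (D : ℂ)))) ∧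
    ((Real.sqrt D : ℝ) : ℂ)⁻¹ *
        (∑ᶠ a : ZMod p, σ a * Complex.exp (2 * π * Complex.I * (a.val : ℂ) / (p : ℂ))) *
        (∑ᶠ a : ZMod (p * D), σ ((a.val : ℕ) : ZMod p) * χD ((a.val : ℕ) : ZMod D) *
          Complex.exp (2 * π * Complex.I * (a.val : ℂ) / ((p : ℂ) * (D : ℂ)))) =
      σ ((D : ℕ) : ZMod p) * χD ((p : ℕ) : ZMod D) *
        (∑ᶠ a : ZMod p, σ a * Complex.exp (2 * π * Complex.I * (a.val : ℂ) / (p : ℂ))) ^ 2 := by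
  have := Fact.mk hp
  have : NeZero D := ⟨hD.ne'⟩
  obtain ⟨ω, c, h⟩ := exists_isQuadraticBasis hrank hD.ne' hdisc hsq
  have hs : sqrtD ^ 2 = D := RingOfIntegers.ext (by simpa using hsq)
  have hsqrt : ((√D : ℝ) : ℂ) ≠ 0 := by
    exact_mod_cast (Real.sqrt_pos.mpr (by exact_mod_cast hD)).ne'
  have hp2 := hσ.prime_ne_two
  have hD0 : (D : ZMod p) ≠ 0 := by rwa [ne_eq, ZMod.natCast_eq_zero_iff]
  have hδδ : ((-1 : ℂ) ^ δ) * (-1) ^ δ = 1 := by rw [← mul_pow]; simp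
  have hform : ∀ a b : ZMod p, 4 * (a ^ 2 + a * b * (D : ZMod p) + b ^ 2 * (c : ZMod p)) =
      (2 * a + b * D) ^ 2 - D * b ^ 2 := fun a b ↦ by
    have h4 := congrArg (Int.cast : ℤ → ZMod p) h.four_mul
    push_cast at h4
    linear_combination b ^ 2 * h4
  rw [finsum_eq_gaussSum, gaussSum_mul_eq ((Nat.Prime.coprime_iff_not_dvd hp).mpr hpD),
    h.gaussSum_eq_sqrt hs hχD, h.finsum_eq σ hg,
    DirichletCharacter.sum_norm_form hp2 hσ.ne_one_of_prime hD0 _ hform, hsign,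
    ← h.apply_eq_quadraticChar hs hχD hp2]
  have heq : ((√D : ℝ) : ℂ)⁻¹ * gaussSum σ ZMod.stdAddChar *
      (σ D * χD p * gaussSum σ ZMod.stdAddChar * (√D : ℝ)) =
        σ D * χD p * gaussSum σ ZMod.stdAddChar ^ 2 := by
    field_simp
  refine ⟨h.differentIdeal_eq hD.ne' hdisc, ?_, heq⟩
  rw [heq]
  linear_combination (σ D * χD p * gaussSum σ ZMod.stdAddChar ^ 2) * hδδ
end

section
/- Let F be a real quadratic field of discriminant D and let χ_D be the quadratic Dirichlet character modulo D attached to F. Let σ be any Dirichlet character modulo a positive integer m. Then for every complex s with Re(s) > 1, Σ_𝔞 σ(N_{F/ℚ}(𝔞))·N_{F/ℚ}(𝔞)^{−s} = (Σ_{n≥1} σ(n)n^{−s}) · (Σ_{n≥1} σ(n)χ_D(n)n^{−s}), where the left-hand sum runs over all nonzero integral ideals 𝔞 of O_F, all three series converging absolutely. -/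
open NumberField

namespace NumberField

open _root_.Ideal

variable (K : Type*) [Field K] [NumberField K]

/-- The number of integral ideals of norm `n`, as an arithmetic function. -/
noncomputable def idealCount : ArithmeticFunction ℕ where
  toFun n := if n = 0 then 0 else Nat.card {I : Ideal (𝓞 K) // absNorm I = n}
  map_zero' := if_pos rfl

variable {K}

lemma idealCount_apply {n : ℕ} (hn : n ≠ 0) :
    idealCount K n = Nat.card {I : Ideal (𝓞 K) // absNorm I = n} :=
  if_neg hn

lemma isCoprime_of_coprime_absNorm {I J : Ideal (𝓞 K)}
    (h : (absNorm I).Coprime (absNorm J)) : IsCoprime I J := by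
  rw [Ideal.isCoprime_iff_codisjoint, codisjoint_iff, eq_top_iff_one]
  have h1 : IsCoprime ((absNorm I : ℕ) : 𝓞 K) ((absNorm J : ℕ) : 𝓞 K) := by
    simpa using (Nat.isCoprime_iff_coprime.mpr h).map (Int.castRingHom (𝓞 K))
  obtain ⟨a, b, hab⟩ := h1
  rw [← hab]
  exact Submodule.add_mem_sup (I.mul_mem_left _ (absNorm_mem I))
    (J.mul_mem_left _ (absNorm_mem J))

lemma exists_mul_eq_of_absNorm_eq_mul {I : Ideal (𝓞 K)} {m n : ℕ} (h : m.Coprime n)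
    (hI : absNorm I = m * n) :
    ∃ A B : Ideal (𝓞 K), absNorm A = m ∧ absNorm B = n ∧ A * B = I := by
  have hdvd : I ∣ span {(m : 𝓞 K)} * span {(n : 𝓞 K)} := by
    rw [span_singleton_mul_span_singleton, dvd_iff_le, ← Nat.cast_mul, ← hI]
    exact span_singleton_absNorm_le I
  obtain ⟨A, B, hA, hB, rfl⟩ := exists_dvd_and_dvd_of_dvd_mul hdvd
  have hA' := absNorm_dvd_absNorm_of_le (le_of_dvd hA)
  have hB' := absNorm_dvd_absNorm_of_le (le_of_dvd hB)
  rw [absNorm_span_natCast] at hA' hB'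
  rw [map_mul] at hI
  have h1 : absNorm A ∣ m :=
    (Nat.Coprime.coprime_dvd_left hA' (h.pow_left _)).dvd_of_dvd_mul_right
      (hI ▸ Dvd.intro _ rfl)
  have h2 : absNorm B ∣ n :=
    (Nat.Coprime.coprime_dvd_left hB' (h.symm.pow_left _)).dvd_of_dvd_mul_left
      (hI ▸ Dvd.intro_left _ rfl)
  have h3 : m ∣ absNorm A :=
    (Nat.Coprime.coprime_dvd_right h2 h).dvd_of_dvd_mul_right (hI ▸ Dvd.intro _ rfl)
  have h4 : n ∣ absNorm B :=
    (Nat.Coprime.coprime_dvd_right h1 h.symm).dvd_of_dvd_mul_left (hI ▸ Dvd.intro_left _ rfl)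
  exact ⟨A, B, Nat.dvd_antisymm h1 h3, Nat.dvd_antisymm h2 h4, rfl⟩

lemma dvd_of_mul_eq_mul_of_coprime_absNorm {A B A' B' : Ideal (𝓞 K)}
    (h : (absNorm A).Coprime (absNorm B')) (hAB : A * B = A' * B') : A ∣ A' :=
  (isCoprime_of_coprime_absNorm h).dvd_of_dvd_mul_right (hAB ▸ Dvd.intro _ rfl)

lemma isMultiplicative_idealCount : (idealCount K).IsMultiplicative := by
  refine ArithmeticFunction.IsMultiplicative.iff_ne_zero.mpr ⟨?_, fun {m n} hm hn h ↦ ?_⟩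
  · rw [idealCount_apply one_ne_zero, Nat.card_eq_one_iff_exists]
    exact ⟨⟨⊤, absNorm_top⟩, fun ⟨I, hI⟩ ↦ Subtype.ext (absNorm_eq_one_iff.mp hI)⟩
  · rw [idealCount_apply hm, idealCount_apply hn, idealCount_apply (mul_ne_zero hm hn),
      ← Nat.card_prod]
    refine (Nat.card_congr (Equiv.ofBijective
      (fun x ↦ ⟨x.1.1 * x.2.1, by rw [map_mul, x.1.2, x.2.2]⟩) ⟨?_, ?_⟩)).symm
    · rintro ⟨⟨A, hA⟩, ⟨B, hB⟩⟩ ⟨⟨A', hA'⟩, ⟨B', hB'⟩⟩ hAB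
      have hAB : A * B = A' * B' := congr_arg Subtype.val hAB
      have hBA : B * A = B' * A' := by rw [mul_comm B, mul_comm B', hAB]
      have h1 : A = A' := dvd_antisymm
        (dvd_of_mul_eq_mul_of_coprime_absNorm (by rwa [hA, hB']) hAB)
        (dvd_of_mul_eq_mul_of_coprime_absNorm (by rwa [hA', hB]) hAB.symm)
      have h2 : B = B' := dvd_antisymm
        (dvd_of_mul_eq_mul_of_coprime_absNorm (by rw [hB, hA']; exact h.symm) hBA)
        (dvd_of_mul_eq_mul_of_coprime_absNorm (by rw [hB', hA]; exact h.symm) hBA.symm)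
      subst h1 h2
      rfl
    · rintro ⟨I, hI⟩
      obtain ⟨A, B, hA, hB, rfl⟩ := exists_mul_eq_of_absNorm_eq_mul h hI
      exact ⟨⟨⟨A, hA⟩, ⟨B, hB⟩⟩, rfl⟩

lemma dvd_span_natCast_pow {I : Ideal (𝓞 K)} {p k : ℕ} (hI : absNorm I = p ^ k) :
    I ∣ span {(p : 𝓞 K)} ^ k := by
  rw [span_singleton_pow, dvd_iff_le, ← Nat.cast_pow, ← hI]
  exact span_singleton_absNorm_le I

lemma idealCount_prime_pow_of_inert {p : ℕ} (hp : p.Prime)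
    (hP : (span {(p : 𝓞 K)}).IsPrime) (hnorm : absNorm (span {(p : 𝓞 K)}) = p ^ 2) (k : ℕ) :
    idealCount K (p ^ k) = if Even k then 1 else 0 := by
  have hP0 : span {(p : 𝓞 K)} ≠ ⊥ := by simpa using hp.ne_zero
  have hpow {I : Ideal (𝓞 K)} (hI : absNorm I = p ^ k) :
      ∃ i, k = 2 * i ∧ I = span {(p : 𝓞 K)} ^ i := by
    obtain ⟨i, -, hi⟩ := (dvd_prime_pow (prime_of_isPrime hP0 hP) k).mp (dvd_span_natCast_pow hI)
    rw [associated_iff_eq] at hi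
    rw [hi, map_pow, hnorm, ← pow_mul] at hI
    exact ⟨i, (Nat.pow_right_injective hp.two_le hI).symm, hi⟩
  rw [idealCount_apply (pow_ne_zero k hp.ne_zero)]
  split_ifs with hk
  · obtain ⟨i, rfl⟩ := hk.two_dvd
    rw [Nat.card_eq_one_iff_exists]
    refine ⟨⟨span {(p : 𝓞 K)} ^ i, by rw [map_pow, hnorm, pow_mul]⟩, fun ⟨I, hI⟩ ↦ ?_⟩
    obtain ⟨j, hj, rfl⟩ := hpow hI
    obtain rfl : i = j := by lia
    rfl
  · rw [Nat.card_eq_zero]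
    refine .inl ⟨fun ⟨I, hI⟩ ↦ hk ?_⟩
    obtain ⟨i, hi, -⟩ := hpow hI
    exact ⟨i, by lia⟩

lemma prime_of_prime_absNorm {P : Ideal (𝓞 K)} (hP : (absNorm P).Prime) : Prime P :=
  prime_of_isPrime (fun h ↦ hP.ne_zero (by rw [h, absNorm_bot]))
    (isPrime_of_irreducible_absNorm hP)

lemma idealCount_prime_pow_of_ramified {p : ℕ} (hp : p.Prime) {P : Ideal (𝓞 K)}
    (hP : absNorm P = p) (hpP : span {(p : 𝓞 K)} = P ^ 2) (k : ℕ) :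
    idealCount K (p ^ k) = 1 := by
  rw [idealCount_apply (pow_ne_zero k hp.ne_zero), Nat.card_eq_one_iff_exists]
  refine ⟨⟨P ^ k, by rw [map_pow, hP]⟩, fun ⟨I, hI⟩ ↦ Subtype.ext ?_⟩
  have hdvd := dvd_span_natCast_pow hI
  rw [hpP, ← pow_mul, dvd_prime_pow (prime_of_prime_absNorm (hP ▸ hp))] at hdvd
  obtain ⟨i, -, hi⟩ := hdvd
  obtain rfl := associated_iff_eq.mp hi
  rw [map_pow, hP] at hI
  exact congr_arg (P ^ ·) (Nat.pow_right_injective hp.two_le hI)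

lemma idealCount_prime_pow_of_split {p : ℕ} (hp : p.Prime) {P Q : Ideal (𝓞 K)}
    (hP : absNorm P = p) (hQ : absNorm Q = p) (hPQ : P ≠ Q)
    (hpPQ : span {(p : 𝓞 K)} = P * Q) (k : ℕ) :
    idealCount K (p ^ k) = k + 1 := by
  have hP' := prime_of_prime_absNorm (hP ▸ hp)
  have hQ' := prime_of_prime_absNorm (hQ ▸ hp)
  have hcop (i j : ℕ) : IsRelPrime (P ^ i) (Q ^ j) := by
    refine IsRelPrime.pow ?_
    rw [hP'.irreducible.isRelPrime_iff_not_dvd]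
    exact fun h ↦ hPQ (associated_iff_eq.mp (hP'.associated_of_dvd hQ' h))
  have hinj {i j i' j' : ℕ} (h : P ^ i * Q ^ j = P ^ i' * Q ^ j') : i ≤ i' := by
    rw [← pow_dvd_pow_iff hP'.ne_zero hP'.not_isUnit]
    exact (hcop i j').dvd_of_dvd_mul_right (h ▸ Dvd.intro _ rfl)
  rw [idealCount_apply (pow_ne_zero k hp.ne_zero), ← Finset.Nat.card_antidiagonal k,
    ← Fintype.card_coe, ← Nat.card_eq_fintype_card]
  refine (Nat.card_congr (Equiv.ofBijective (fun x ↦ ⟨P ^ x.1.1 * Q ^ x.1.2,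
    by rw [map_mul, map_pow, map_pow, hP, hQ, ← pow_add, Finset.HasAntidiagonal.mem_antidiagonal.mp x.2]⟩)
    ⟨?_, ?_⟩)).symm
  · rintro ⟨⟨i, j⟩, hij⟩ ⟨⟨i', j'⟩, hij'⟩ h
    have h : P ^ i * Q ^ j = P ^ i' * Q ^ j' := congr_arg Subtype.val h
    rw [Finset.HasAntidiagonal.mem_antidiagonal] at hij hij'
    have h1 := hinj h
    have h2 := hinj h.symm
    simp only [Subtype.mk.injEq, Prod.mk.injEq]
    lia
  · rintro ⟨I, hI⟩
    have hdvd := dvd_span_natCast_pow hI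
    rw [hpPQ, mul_pow] at hdvd
    obtain ⟨A, B, hA, hB, rfl⟩ := exists_dvd_and_dvd_of_dvd_mul hdvd
    obtain ⟨i, -, hi⟩ := (dvd_prime_pow hP' k).mp hA
    obtain ⟨j, -, hj⟩ := (dvd_prime_pow hQ' k).mp hB
    obtain rfl := associated_iff_eq.mp hi
    obtain rfl := associated_iff_eq.mp hj
    rw [map_mul, map_pow, map_pow, hP, hQ, ← pow_add] at hI
    exact ⟨⟨(i, j), Finset.HasAntidiagonal.mem_antidiagonal.mpr (Nat.pow_right_injective hp.two_le hI)⟩, rfl⟩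

lemma natCast_dvd_discr_iff {p : ℕ} (hp : p.Prime) :
    (p : ℤ) ∣ discr K ↔ ∃ P : Ideal (𝓞 K), P.IsPrime ∧ P ^ 2 ∣ span {(p : 𝓞 K)} := by
  rw [← not_iff_not, not_dvd_discr_iff_forall_mem K (𝓞 K) (Nat.prime_iff_prime_int.mp hp)]
  have hmap : (span {(p : ℤ)}).map (algebraMap ℤ (𝓞 K)) = span {(p : 𝓞 K)} := by
    simp [map_span]
  have key {P : Ideal (𝓞 K)} (hP : P.IsPrime) (hle : span {(p : 𝓞 K)} ≤ P) :
      Algebra.IsUnramifiedAt ℤ P ↔ ¬ P ^ 2 ∣ span {(p : 𝓞 K)} := by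
    have hlo : P.LiesOver (span {(p : ℤ)}) :=
      (liesOver_span_iff hP.ne_top (Nat.prime_iff_prime_int.mp hp)).mpr
        (by simpa [span_le] using hle)
    rw [← ramificationIdx_eq_one_iff,
      ← ramificationIdx'_eq_ramificationIdx (span {(p : ℤ)}) P (by simpa using hp.ne_zero),
      dvd_iff_le, ← hmap, ← ramificationIdx'_ne_one_iff (hmap ▸ hle), not_not]
  push Not
  constructor
  · intro h P hP hdvd
    have hle : span {(p : 𝓞 K)} ≤ P := (le_of_dvd hdvd).trans (pow_le_self two_ne_zero)
    exact (key hP hle).mp (h P hP (by simpa [span_le] using hle)) hdvd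
  · intro h P hP hpP
    exact (key hP (by simpa [span_le] using hpP)).mpr (h P hP)

lemma exists_span_natCast_eq_mul (hK : Module.finrank ℚ K = 2) {p : ℕ} (hp : p.Prime)
    (hspan : ¬ (span {(p : 𝓞 K)}).IsPrime) :
    ∃ P Q : Ideal (𝓞 K), absNorm P = p ∧ absNorm Q = p ∧ span {(p : 𝓞 K)} = P * Q := by
  have hnorm : absNorm (span {(p : 𝓞 K)}) = p ^ 2 := by
    rw [absNorm_span_natCast, RingOfIntegers.rank, hK]
  have htop : span {(p : 𝓞 K)} ≠ ⊤ := by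
    intro h
    rw [h, absNorm_top, eq_comm, Nat.pow_eq_one] at hnorm
    exact hnorm.elim hp.ne_one two_ne_zero
  obtain ⟨P, hP, hle⟩ := exists_le_maximal _ htop
  obtain ⟨Q, hPQ⟩ := dvd_iff_le.mpr hle
  rw [hPQ, map_mul, hp.mul_eq_prime_sq_iff] at hnorm
  · exact ⟨P, Q, hnorm.1, hnorm.2, hPQ⟩
  · exact fun h ↦ hP.ne_top (absNorm_eq_one_iff.mp h)
  · intro h
    rw [absNorm_eq_one_iff.mp h, mul_top] at hPQ
    exact hspan (hPQ ▸ hP.isPrime)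

lemma eq_of_dvd_discr {p : ℕ} (hp : p.Prime) (hdvd : (p : ℤ) ∣ discr K)
    {P Q : Ideal (𝓞 K)} (hP : absNorm P = p) (hQ : absNorm Q = p)
    (hPQ : span {(p : 𝓞 K)} = P * Q) : P = Q := by
  have hP' := prime_of_prime_absNorm (hP ▸ hp)
  have hQ' := prime_of_prime_absNorm (hQ ▸ hp)
  obtain ⟨R, hR, hRp⟩ := (natCast_dvd_discr_iff hp).mp hdvd
  rw [hPQ, sq] at hRp
  have hR0 : R ≠ 0 := by
    rintro rfl
    rw [zero_mul, zero_dvd_iff] at hRp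
    exact mul_ne_zero hP'.ne_zero hQ'.ne_zero hRp
  have hR' := prime_of_isPrime hR0 hR
  rcases hR'.dvd_or_dvd (dvd_of_mul_left_dvd hRp) with h | h
  · obtain rfl := associated_iff_eq.mp (hR'.associated_of_dvd hP' h)
    exact associated_iff_eq.mp (hR'.associated_of_dvd hQ' ((mul_dvd_mul_iff_left hR0).mp hRp))
  · obtain rfl := associated_iff_eq.mp (hR'.associated_of_dvd hQ' h)
    exact (associated_iff_eq.mp
      (hR'.associated_of_dvd hP' ((mul_dvd_mul_iff_right hR0).mp hRp))).symm

lemma not_isPrime_span_of_dvd_discr {p : ℕ} (hp : p.Prime) (hdvd : (p : ℤ) ∣ discr K) :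
    ¬ (span {(p : 𝓞 K)}).IsPrime := by
  intro hspan
  obtain ⟨R, hR, hRp⟩ := (natCast_dvd_discr_iff hp).mp hdvd
  have hprime := prime_of_isPrime (by simpa using hp.ne_zero) hspan
  exact hR.ne_top (isUnit_iff.mp (hprime.irreducible.squarefree R (sq R ▸ hRp)))

lemma natCast_idealCount_eq_zetaMul (hK : Module.finrank ℚ K = 2) {D : ℕ}
    (hdisc : discr K = D) (χ : DirichletCharacter ℂ D)
    (hχ : ∀ p : ℕ, p.Prime → ¬ p ∣ D →
      ((span {(p : 𝓞 K)}).IsPrime → χ p = -1) ∧ (¬ (span {(p : 𝓞 K)}).IsPrime → χ p = 1)) :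
    (idealCount K : ArithmeticFunction ℂ) = χ.zetaMul := by
  rw [isMultiplicative_idealCount.natCast.eq_iff_eq_on_prime_powers _ _
    χ.isMultiplicative_zetaMul]
  intro p k hp
  have hdvd : (p : ℤ) ∣ discr K ↔ p ∣ D := by rw [hdisc, Int.natCast_dvd_natCast]
  have hzeta : χ.zetaMul (p ^ k) = ∑ i ∈ Finset.range (k + 1), χ p ^ i := by
    rw [DirichletCharacter.zetaMul, ArithmeticFunction.coe_zeta_mul_apply,
      Nat.sum_divisors_prime_pow hp]
    refine Finset.sum_congr rfl fun i _ ↦ ?_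
    rw [← DirichletCharacter.apply_eq_toArithmeticFunction_apply χ (pow_ne_zero _ hp.ne_zero),
      Nat.cast_pow, map_pow]
  rw [hzeta, ArithmeticFunction.natCoe_apply]
  by_cases hpD : p ∣ D
  · have hχp : χ p = 0 := by
      refine χ.map_nonunit ?_
      rw [ZMod.isUnit_iff_coprime, hp.coprime_iff_not_dvd, not_not]
      exact hpD
    obtain ⟨P, Q, hP, hQ, hPQ⟩ :=
      exists_span_natCast_eq_mul hK hp (not_isPrime_span_of_dvd_discr hp (hdvd.mpr hpD))
    obtain rfl := eq_of_dvd_discr hp (hdvd.mpr hpD) hP hQ hPQ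
    rw [idealCount_prime_pow_of_ramified hp hP (hPQ.trans (sq P).symm), hχp,
      Finset.sum_range_succ']
    simp
  · by_cases hspan : (span {(p : 𝓞 K)}).IsPrime
    · rw [idealCount_prime_pow_of_inert hp hspan
        (by rw [absNorm_span_natCast, RingOfIntegers.rank, hK]), (hχ p hp hpD).1 hspan,
        neg_one_geom_sum]
      by_cases hk : Even k <;> simp [hk, Nat.even_add_one]
    · obtain ⟨P, Q, hP, hQ, hPQ⟩ := exists_span_natCast_eq_mul hK hp hspan
      have hne : P ≠ Q := by
        rintro rfl
        exact hpD (hdvd.mp ((natCast_dvd_discr_iff hp).mpr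
          ⟨P, isPrime_of_prime (prime_of_prime_absNorm (hP ▸ hp)), by rw [hPQ, sq]⟩))
      rw [idealCount_prime_pow_of_split hp hP hQ hne hPQ, (hχ p hp hpD).2 hspan]
      simp

/-- The norm of a nonzero integral ideal, as a positive natural number. -/
noncomputable def absNormPNat (I : {I : Ideal (𝓞 K) // I ≠ ⊥}) : ℕ+ :=
  ⟨absNorm I.1, Nat.pos_of_ne_zero (absNorm_eq_zero_iff.not.mpr I.2)⟩

@[simp]
lemma coe_absNormPNat (I : {I : Ideal (𝓞 K) // I ≠ ⊥}) : (absNormPNat I : ℕ) = absNorm I.1 :=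
  rfl

/-- The nonzero ideals of norm `n > 0` are the ideals of norm `n`. -/
def absNormPNatFiberEquiv (n : ℕ+) :
    {I : {I : Ideal (𝓞 K) // I ≠ ⊥} // absNormPNat I = n} ≃
      {I : Ideal (𝓞 K) // absNorm I = n} where
  toFun I := ⟨I.1.1, congr_arg PNat.val I.2⟩
  invFun I := ⟨⟨I.1, fun h ↦ n.ne_zero (by rw [← I.2, h, absNorm_bot])⟩, PNat.coe_injective I.2⟩

instance finite_absNormPNat_fiber (n : ℕ+) :
    Finite {I : {I : Ideal (𝓞 K) // I ≠ ⊥} // absNormPNat I = n} :=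
  have : Finite {I : Ideal (𝓞 K) // absNorm I = n} := finite_setOfPred_absNorm_eq _
  .of_equiv _ (absNormPNatFiberEquiv n).symm

lemma card_absNormPNat_fiber (n : ℕ+) :
    Nat.card {I : {I : Ideal (𝓞 K) // I ≠ ⊥} // absNormPNat I = n} = idealCount K n := by
  rw [idealCount_apply n.ne_zero, Nat.card_congr (absNormPNatFiberEquiv n)]

lemma tsum_absNormPNat_fiber {E : Type*} [NormedField E] (g : ℕ+ → E) (n : ℕ+) :
    ∑' I : {I : {I : Ideal (𝓞 K) // I ≠ ⊥} // absNormPNat I = n}, g (absNormPNat I.1) =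
      idealCount K n * g n := by
  simp_rw [fun I : {I : {I : Ideal (𝓞 K) // I ≠ ⊥} // absNormPNat I = n} ↦ I.2]
  rw [tsum_const, card_absNormPNat_fiber, nsmul_eq_mul]

lemma summable_norm_comp_absNormPNat {g : ℕ+ → ℂ}
    (hg : Summable fun n : ℕ+ ↦ ‖(idealCount K n : ℂ) * g n‖) :
    Summable fun I : {I : Ideal (𝓞 K) // I ≠ ⊥} ↦ ‖g (absNormPNat I)‖ := by
  rw [← (Equiv.sigmaFiberEquiv (absNormPNat (K := K))).summable_iff]
  refine (summable_sigma_of_nonneg fun _ ↦ norm_nonneg _).mpr ⟨fun n ↦ ?_, ?_⟩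
  · exact Summable.of_finite
  · refine hg.congr fun n ↦ ?_
    rw [norm_mul, RCLike.norm_natCast]
    exact (tsum_absNormPNat_fiber (fun n ↦ ‖g n‖) n).symm

lemma tsum_comp_absNormPNat {g : ℕ+ → ℂ}
    (hg : Summable fun n : ℕ+ ↦ ‖(idealCount K n : ℂ) * g n‖) :
    ∑' I : {I : Ideal (𝓞 K) // I ≠ ⊥}, g (absNormPNat I) =
      ∑' n : ℕ+, (idealCount K n : ℂ) * g n := by
  have h := (summable_norm_comp_absNormPNat hg).of_norm
  rw [← (Equiv.sigmaFiberEquiv (absNormPNat (K := K))).summable_iff] at h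
  rw [← (Equiv.sigmaFiberEquiv (absNormPNat (K := K))).tsum_eq]
  refine h.tsum_sigma.trans ?_
  exact tsum_congr fun n ↦ tsum_absNormPNat_fiber g n

lemma convolution_eq_idealCount (hK : Module.finrank ℚ K = 2) {D m : ℕ}
    (hdisc : discr K = D) (χ : DirichletCharacter ℂ D) (σ : DirichletCharacter ℂ m)
    (hχ : ∀ p : ℕ, p.Prime → ¬ p ∣ D →
      ((span {(p : 𝓞 K)}).IsPrime → χ p = -1) ∧ (¬ (span {(p : 𝓞 K)}).IsPrime → χ p = 1)) :
    LSeries.convolution (fun n ↦ σ n) (fun n ↦ σ n * χ n) =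
      fun n : ℕ ↦ σ n * (idealCount K n : ℂ) := by
  have h := DirichletCharacter.mul_convolution_distrib σ 1 (fun n ↦ χ n)
  rw [mul_one] at h
  have hζ : toArithmeticFunction (fun n ↦ (ArithmeticFunction.zeta n : ℂ)) =
      (ArithmeticFunction.zeta : ArithmeticFunction ℂ) := by
    simp_rw [← ArithmeticFunction.natCoe_apply]
    exact ArithmeticFunction.toArithmeticFunction_eq_self _
  refine h.trans (funext fun n ↦ congr_arg (σ n * ·) ?_)
  rw [LSeries.one_convolution_eq_zeta_convolution, ← ArithmeticFunction.natCoe_apply,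
    natCast_idealCount_eq_zetaMul hK hdisc χ hχ, DirichletCharacter.zetaMul, LSeries.convolution,
    hζ]

end NumberField

lemma LSeries.term_pnat (f : ℕ → ℂ) (s : ℂ) (n : ℕ+) :
    LSeries.term f s n = f n * (n : ℂ) ^ (-s) := by
  rw [LSeries.term_of_ne_zero n.ne_zero, Complex.cpow_neg, div_eq_mul_inv]

lemma LSeriesSummable.summable_norm_pnat {f : ℕ → ℂ} {s : ℂ} (hf : LSeriesSummable f s) :
    Summable fun n : ℕ+ ↦ ‖f n * (n : ℂ) ^ (-s)‖ := by
  simp_rw [← LSeries.term_pnat]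
  exact hf.norm.comp_injective PNat.coe_injective

lemma LSeries_eq_tsum_pnat (f : ℕ → ℂ) (s : ℂ) :
    LSeries f s = ∑' n : ℕ+, f n * (n : ℂ) ^ (-s) := by
  simp_rw [← LSeries.term_pnat]
  refine (PNat.coe_injective.tsum_eq fun n hn ↦ ?_).symm
  refine ⟨⟨n, Nat.pos_of_ne_zero ?_⟩, rfl⟩
  rintro rfl
  exact hn (LSeries.term_zero f s)

/-- for a real quadratic field `F` of discriminant `D` with attached quadratic
character `χ_D`, and any Dirichlet character `σ` mod `m`, for `Re(s) > 1` one has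
`Σ_𝔞 σ(N𝔞) N𝔞^{−s} = (Σ_n σ(n) n^{−s})·(Σ_n σ(n)χ_D(n) n^{−s})`, all three series
converging absolutely. -/
theorem statement_13
    (F : Type*) [Field F] [NumberField F]
    (hrank : Module.finrank ℚ F = 2)
    (φ₁ φ₂ : F →+* ℝ) (hφ : φ₁ ≠ φ₂)
    (D : ℕ) (hD : 0 < D) (hdisc : NumberField.discr F = (D : ℤ))
    (χD : DirichletCharacter ℂ D)
    (hχD : ∀ p : ℕ, p.Prime → ¬ p ∣ D →
      ((Ideal.span {(p : 𝓞 F)}).IsPrime → χD (p : ZMod D) = -1) ∧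
      (¬ (Ideal.span {(p : 𝓞 F)}).IsPrime → χD (p : ZMod D) = 1))
    (m : ℕ) (hm : 0 < m) (σ : DirichletCharacter ℂ m)
    (s : ℂ) (hs : 1 < s.re) :
    Summable (fun 𝔞 : {I : Ideal (𝓞 F) // I ≠ ⊥} =>
      ‖σ (Ideal.absNorm 𝔞.1 : ZMod m) * (Ideal.absNorm 𝔞.1 : ℂ) ^ (-s)‖) ∧
    Summable (fun n : ℕ+ => ‖σ ((n : ℕ) : ZMod m) * (n : ℂ) ^ (-s)‖) ∧
    Summable (fun n : ℕ+ =>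
      ‖σ ((n : ℕ) : ZMod m) * χD ((n : ℕ) : ZMod D) * (n : ℂ) ^ (-s)‖) ∧
    (∑' 𝔞 : {I : Ideal (𝓞 F) // I ≠ ⊥},
        σ (Ideal.absNorm 𝔞.1 : ZMod m) * (Ideal.absNorm 𝔞.1 : ℂ) ^ (-s)) =
      (∑' n : ℕ+, σ ((n : ℕ) : ZMod m) * (n : ℂ) ^ (-s)) *
      (∑' n : ℕ+, σ ((n : ℕ) : ZMod m) * χD ((n : ℕ) : ZMod D) * (n : ℂ) ^ (-s)) := by
  have hσ := σ.LSeriesSummable_of_one_lt_re hs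
  have hσχ : LSeriesSummable (fun n : ℕ ↦ σ n * χD n) s :=
    σ.LSeriesSummable_mul (χD.LSeriesSummable_of_one_lt_re hs)
  have hconv := convolution_eq_idealCount hrank hdisc χD σ hχD
  have hprod := (hσ.convolution hσχ).summable_norm_pnat
  have hL := LSeries_convolution' hσ hσχ
  rw [hconv] at hprod hL
  have hterm (n : ℕ+) : σ (n : ℕ) * (idealCount F n : ℂ) * (n : ℂ) ^ (-s) =
      idealCount F n * (σ (n : ℕ) * (n : ℂ) ^ (-s)) := by ring
  simp_rw [LSeries_eq_tsum_pnat, hterm] at hprod hL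
  refine ⟨?_, hσ.summable_norm_pnat, hσχ.summable_norm_pnat, ?_⟩
  · simpa using summable_norm_comp_absNormPNat hprod
  · rw [← hL, ← tsum_comp_absNormPNat hprod]
    simp
end

section
/- Let ν ∈ iℝ, A > 0, T ∈ ℂ, and let a, b : {1,2,3,…} → ℂ be sequences such that Σ_{n≥1} |a(n)|n^{−σ₀} and Σ_{n≥1} |b(n)|n^{−σ₀} converge for some real σ₀. Define f(y) = Σ_{n≥1} a(n)·√y·K_ν(2πny) and g(y) = Σ_{n≥1} b(n)·√y·K_ν(2πny) for y > 0, and for Re(s) > σ₀ define Λ_a(s) = π^{−s}A^{s/2}Γ((s+ν)/2)Γ((s−ν)/2)·Σ_{n≥1} a(n)n^{−s} and Λ_b(s) analogously. Assume Λ_a and Λ_b extend to entire functions on ℂ that are bounded on every vertical strip {σ₁ ≤ Re(s) ≤ σ₂}, and that Λ_a(s) = T·Λ_b(1−s) for all s ∈ ℂ. Then f(y) = T·g(1/(Ay)) for every y > 0. -/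
open scoped Real

/-- The K-Bessel function `K_ν(y) = (1/2)∫₀^∞ e^{−y(t+t⁻¹)/2} t^ν dt/t`. -/
noncomputable def KBessel (ν : ℂ) (y : ℝ) : ℂ :=
  (1 / 2) * ∫ t in Set.Ioi (0 : ℝ),
    Complex.exp (-(y : ℂ) * ((t : ℂ) + (t : ℂ)⁻¹) / 2) * (t : ℂ) ^ ν / (t : ℂ)

open Complex MeasureTheory Set Filter Topology

theorem norm_Gamma_le_Gamma_re {s : ℂ} (hs : 0 < s.re) : ‖Gamma s‖ ≤ Real.Gamma s.re := by
  rw [Gamma_eq_integral hs, Real.Gamma_eq_integral hs, GammaIntegral]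
  refine (norm_integral_le_integral_norm _).trans_eq
    (setIntegral_congr_fun measurableSet_Ioi fun x hx => ?_)
  simp [norm_cpow_eq_rpow_re_of_pos (mem_Ioi.1 hx), norm_exp]

theorem continuous_Gamma_vertical {σ : ℝ} (hσ : 0 < σ) :
    Continuous fun v : ℝ => Gamma (σ + v * I) := by
  refine continuous_iff_continuousAt.2 fun v => ?_
  have h : ContinuousAt Gamma (σ + v * I) := by
    refine (differentiableAt_Gamma _ fun m h => ?_).continuousAt
    have := congrArg re h
    simp at this
    have : (0 : ℝ) ≤ m := m.cast_nonneg
    linarith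
  exact ContinuousAt.comp (f := fun v : ℝ => (σ + v * I : ℂ)) h (by fun_prop)

theorem integrable_Gamma_vertical {σ : ℝ} (hσ : 1 ≤ σ) :
    Integrable fun v : ℝ => Gamma (σ + v * I) := by
  refine (integrable_inv_one_add_sq.const_mul (Real.Gamma (σ + 2))).mono'
    (continuous_Gamma_vertical (by linarith)).aestronglyMeasurable (.of_forall fun v => ?_)
  set s : ℂ := σ + v * I with hs
  have hre : s.re = σ := by simp [hs]
  have him : s.im = v := by simp [hs]
  have h0 : s ≠ 0 := fun h => by rw [h] at hre; simp at hre; linarith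
  have h1 : s + 1 ≠ 0 := fun h => by
    have := congrArg re h
    simp [hre] at this
    linarith
  have hG : Gamma (s + 2) = (s + 1) * s * Gamma s := by
    rw [show s + 2 = (s + 1) + 1 by ring, Gamma_add_one _ h1, Gamma_add_one _ h0, mul_assoc]
  have hb : ‖Gamma (s + 2)‖ ≤ Real.Gamma (σ + 2) := by
    have := norm_Gamma_le_Gamma_re (s := s + 2) (by simp [hre]; linarith)
    simpa [hre] using this
  have hns : 1 + v ^ 2 ≤ ‖s‖ ^ 2 := by
    rw [← normSq_eq_norm_sq, normSq_apply, hre, him]; nlinarith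
  have hns1 : ‖s‖ ^ 2 ≤ ‖s + 1‖ ^ 2 := by
    rw [← normSq_eq_norm_sq, ← normSq_eq_norm_sq, normSq_apply, normSq_apply]
    simp [hre, him]; nlinarith
  have hle : ‖s‖ ≤ ‖s + 1‖ := by
    exact (pow_le_pow_iff_left₀ (norm_nonneg _) (norm_nonneg _) two_ne_zero).1 hns1
  have hprod : 1 + v ^ 2 ≤ ‖s + 1‖ * ‖s‖ := by nlinarith [norm_nonneg s]
  rw [hG, norm_mul, norm_mul] at hb
  rw [← div_eq_mul_inv, le_div_iff₀ (by positivity)]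
  nlinarith [norm_nonneg (Gamma s)]

/-- The Cahen–Mellin integral for `exp (-u)`. -/
theorem exp_neg_eq_integral_Gamma {σ u : ℝ} (hσ : 1 ≤ σ) (hu : 0 < u) :
    (Real.exp (-u) : ℂ) =
      1 / (2 * π) * ∫ v : ℝ, (u : ℂ) ^ (-(σ + v * I)) * Gamma (σ + v * I) := by
  have hm : ∀ v : ℝ, mellin (fun x : ℝ => (Real.exp (-x) : ℂ)) (σ + v * I) =
      Gamma (σ + v * I) := fun v => by
    rw [← GammaIntegral_eq_mellin, Gamma_eq_integral (by simp; linarith)]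
  have h := mellinInv_mellin_eq σ (fun x : ℝ => (Real.exp (-x) : ℂ)) hu
    (by
      have := GammaIntegral_convergent (s := σ) (by simp; linarith)
      simpa [MellinConvergent, mul_comm] using this)
    (by
      unfold VerticalIntegrable
      simpa only [hm] using integrable_Gamma_vertical hσ)
    (by fun_prop)
  rw [← h, mellinInv]
  simp only [hm, smul_eq_mul, real_smul]
  push_cast
  rfl

theorem integral_vertical_half (F : ℂ → ℂ) (σ : ℝ) {ν : ℂ} (hν : ν.re = 0) :
    ∫ v : ℝ, F ((σ / 2 : ℝ) + v * I) = (1 / 2) * ∫ v : ℝ, F ((σ + v * I - ν) / 2) := by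
  have e : ν = ν.im * I := by
    apply Complex.ext <;> simp [hν]
  have h1 := integral_add_right_eq_self (μ := volume)
    (fun v : ℝ => F ((σ / 2 : ℝ) + v * I)) (-(ν.im / 2))
  have h2 := Measure.integral_comp_mul_left
    (fun v : ℝ => F ((σ / 2 : ℝ) + (v + -(ν.im / 2) : ℝ) * I)) (1 / 2)
  have h3 : ∀ v : ℝ, ((σ / 2 : ℝ) : ℂ) + (1 / 2 * v + -(ν.im / 2) : ℝ) * I =
      (σ + v * I - ν) / 2 := fun v => by
    conv_rhs => rw [e]
    push_cast
    ring
  simp only [h3] at h2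
  rw [h2, ← h1]
  simp

/-- `K_ν` as an inverse Mellin transform of a product of two Gamma functions. -/
theorem KBessel_two_mul {ν : ℂ} (hν : ν.re = 0) {σ x : ℝ} (hσ : 2 ≤ σ) (hx : 0 < x) :
    KBessel ν (2 * x) = 1 / (8 * π) * ∫ v : ℝ, (x : ℂ) ^ (-(σ + v * I)) *
      (Gamma ((σ + v * I + ν) / 2) * Gamma ((σ + v * I - ν) / 2)) := by
  set c := σ / 2 with hc
  have hc1 : 1 ≤ c := by linarith
  have hx0 : (x : ℂ) ≠ 0 := ofReal_ne_zero.2 hx.ne'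
  set G : ℝ → ℝ → ℂ := fun t v => (Real.exp (-(x * t)) : ℂ) * (t : ℂ) ^ (ν - 1) *
    ((x : ℂ) ^ (-(c + v * I)) * (t : ℂ) ^ (c + v * I) * Gamma (c + v * I)) with hG
  have hint : Integrable (Function.uncurry G) ((volume.restrict (Ioi (0 : ℝ))).prod volume) := by
    have h1 : Integrable (fun t : ℝ => Real.exp (-(x * t)) * t ^ (c - 1) * x ^ (-c))
        (volume.restrict (Ioi (0 : ℝ))) := by
      refine Integrable.mul_const ?_ _
      have := integrableOn_rpow_mul_exp_neg_mul_rpow (p := 1) (s := c - 1) (by linarith) one_pos hx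
      simpa [IntegrableOn, mul_comm] using this
    have h2 := (h1.mul_prod (integrable_Gamma_vertical hc1).norm)
    refine h2.mono' ?_ ?_
    · have := (continuous_Gamma_vertical (σ := c) (by linarith)).measurable
      refine Measurable.aestronglyMeasurable ?_
      simp only [hG, Function.uncurry_def]
      have hw : Measurable fun p : ℝ × ℝ => (c + p.2 * I : ℂ) := by fun_prop
      have ht : Measurable fun p : ℝ × ℝ => (p.1 : ℂ) := by fun_prop
      have he : Measurable fun p : ℝ × ℝ => (Real.exp (-(x * p.1)) : ℂ) := by fun_prop
      exact (he.mul (ht.pow_const _)).mul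
        (((measurable_const.pow hw.neg).mul (ht.pow hw)).mul (this.comp measurable_snd))
    · have : ∀ᵐ p ∂((volume.restrict (Ioi (0 : ℝ))).prod (volume : Measure ℝ)), 0 < p.1 := by
        refine Measure.quasiMeasurePreserving_fst.ae ?_
        exact ae_restrict_mem measurableSet_Ioi
      filter_upwards [this] with p hp
      simp only [hG, Function.uncurry_def, norm_mul, norm_cpow_eq_rpow_re_of_pos hp,
        norm_cpow_eq_rpow_re_of_pos hx, norm_real, Real.norm_eq_abs, Real.abs_exp]
      simp only [sub_re, hν, one_re, neg_re, add_re, ofReal_re, mul_re, I_re, mul_zero, ofReal_im,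
        I_im, mul_one, sub_zero, add_zero]
      rw [show c - 1 = (0 - 1) + c by ring, Real.rpow_add hp]
      apply le_of_eq
      ring
  have hinner : ∀ v : ℝ, ∫ t in Ioi (0 : ℝ), G t v =
      (x : ℂ) ^ (-(2 * (c + v * I) + ν)) * (Gamma (c + v * I + ν) * Gamma (c + v * I)) := by
    intro v
    have h := Complex.integral_cpow_mul_exp_neg_mul_Ioi (a := c + v * I + ν) (r := x)
      (by simp [hν]; linarith) (by simpa using hx)
    have h3 : ∀ t ∈ Ioi (0 : ℝ), G t v = ((x : ℂ) ^ (-(c + v * I)) * Gamma (c + v * I)) *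
        ((t : ℂ) ^ (c + v * I + ν - 1) * cexp (-(x * t))) := by
      intro t ht
      have ht0 : (t : ℂ) ≠ 0 := ofReal_ne_zero.2 (mem_Ioi.1 ht).ne'
      simp only [hG]
      rw [show (c + v * I + ν - 1 : ℂ) = (ν - 1) + (c + v * I) by ring,
        cpow_add (ν - 1) (c + v * I) ht0]
      push_cast
      ring
    rw [setIntegral_congr_fun measurableSet_Ioi h3, integral_const_mul, h,
      show (-(2 * (c + v * I) + ν) : ℂ) = -(c + v * I) + -(c + v * I + ν) by ring,
      cpow_add _ _ hx0, one_div,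
      inv_cpow _ _ (by rw [arg_ofReal_of_nonneg hx.le]; exact Real.pi_pos.ne),
      ← cpow_neg]
    ring
  have hK : KBessel ν (2 * x) = 1 / (4 * π) * ∫ t in Ioi (0 : ℝ), ∫ v : ℝ, G t v := by
    rw [KBessel, show (1 / (4 * π) : ℂ) = (1 / 2) * (1 / (2 * π)) by ring, mul_assoc,
      ← integral_const_mul (1 / (2 * π) : ℂ)]
    congr 1
    refine setIntegral_congr_fun measurableSet_Ioi fun t ht => ?_
    have ht' : 0 < t := ht
    have ht0 : (t : ℂ) ≠ 0 := ofReal_ne_zero.2 ht'.ne'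
    have h := exp_neg_eq_integral_Gamma hc1 (div_pos hx ht')
    have h4 : ∀ v : ℝ, ((x / t : ℝ) : ℂ) ^ (-(c + v * I)) =
        (x : ℂ) ^ (-(c + v * I)) * (t : ℂ) ^ (c + v * I) := fun v => by
      rw [div_eq_mul_inv, ofReal_mul, mul_cpow_ofReal_nonneg hx.le (inv_pos.2 ht').le, ofReal_inv,
        inv_cpow _ _ (by rw [arg_ofReal_of_nonneg ht'.le]; exact Real.pi_pos.ne),
        cpow_neg _ (c + v * I), cpow_neg (t : ℂ), inv_inv]
    simp only [h4] at h
    simp only [hG]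
    rw [integral_const_mul, mul_left_comm, ← h, cpow_sub _ _ ht0, cpow_one, mul_right_comm,
      ← ofReal_mul, ← Real.exp_add]
    push_cast
    rw [mul_div_assoc]
    congr 2
    field_simp
    ring
  rw [hK, integral_integral_swap hint]
  simp only [hinner]
  rw [integral_vertical_half (fun w => (x : ℂ) ^ (-(2 * w + ν)) * (Gamma (w + ν) * Gamma w)) σ hν,
    ← mul_assoc]
  congr 1
  · ring
  · congr 1 with v
    congr 3 <;> ring_nf

theorem integral_vertical_eq_of_decay {H : ℂ → ℂ} (hd : Differentiable ℂ H) {σ₁ σ₂ : ℝ}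
    (h₁ : Integrable fun v : ℝ => H (σ₁ + v * I)) (h₂ : Integrable fun v : ℝ => H (σ₂ + v * I))
    {B : ℝ → ℝ} (hB : ∀ x ∈ uIcc σ₁ σ₂, ∀ v : ℝ, ‖H (x + v * I)‖ ≤ B (v ^ 2))
    (hB0 : Tendsto B atTop (𝓝 0)) :
    ∫ v : ℝ, H (σ₁ + v * I) = ∫ v : ℝ, H (σ₂ + v * I) := by
  have hBsq : Tendsto (fun R : ℝ => B (R ^ 2) * |σ₂ - σ₁|) atTop (𝓝 0) := by
    simpa using (hB0.comp (tendsto_pow_atTop two_ne_zero)).mul_const |σ₂ - σ₁|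
  have hhor : ∀ ε : ℝ, ε ^ 2 = 1 →
      Tendsto (fun R : ℝ => ∫ x in σ₁..σ₂, H (x + (ε * R : ℝ) * I)) atTop (𝓝 0) := by
    intro ε hε
    refine squeeze_zero_norm (fun R => ?_) hBsq
    refine intervalIntegral.norm_integral_le_of_norm_le_const fun x hx => ?_
    have := hB x (uIoc_subset_uIcc hx) (ε * R)
    rwa [mul_pow, hε, one_mul] at this
  have hv : ∀ σ : ℝ, Integrable (fun v : ℝ => H (σ + v * I)) →
      Tendsto (fun R : ℝ => ∫ v in -R..R, H (σ + v * I)) atTop (𝓝 (∫ v : ℝ, H (σ + v * I))) :=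
    fun σ h => intervalIntegral_tendsto_integral h tendsto_neg_atTop_atBot tendsto_id
  have hrect : ∀ R : ℝ, (∫ x in σ₁..σ₂, H (x + ((-1) * R : ℝ) * I)) -
      (∫ x in σ₁..σ₂, H (x + (1 * R : ℝ) * I)) + I * (∫ v in -R..R, H (σ₂ + v * I)) -
      I * (∫ v in -R..R, H (σ₁ + v * I)) = 0 := by
    intro R
    simpa using integral_boundary_rect_eq_zero_of_differentiableOn H ⟨σ₁, -R⟩ ⟨σ₂, R⟩
      hd.differentiableOn
  have hlim := (((hhor (-1) (by norm_num)).sub (hhor 1 (by norm_num))).add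
    ((hv σ₂ h₂).const_mul I)).sub ((hv σ₁ h₁).const_mul I)
  simp only [hrect] at hlim
  have := tendsto_nhds_unique hlim tendsto_const_nhds
  rw [sub_zero, zero_add, ← mul_sub, mul_eq_zero, or_iff_right I_ne_zero, sub_eq_zero] at this
  exact this.symm

/-- An entire function that is bounded on a vertical strip and integrable along its two edges has
the same integral along both. -/
theorem integral_vertical_eq_of_bounded {G : ℂ → ℂ} (hd : Differentiable ℂ G) {σ₁ σ₂ C : ℝ}
    (h₁ : Integrable fun v : ℝ => G (σ₁ + v * I)) (h₂ : Integrable fun v : ℝ => G (σ₂ + v * I))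
    (hG : ∀ x ∈ uIcc σ₁ σ₂, ∀ v : ℝ, ‖G (x + v * I)‖ ≤ C) :
    ∫ v : ℝ, G (σ₁ + v * I) = ∫ v : ℝ, G (σ₂ + v * I) := by
  have hnorm : ∀ ε x v : ℝ, ‖cexp (ε * (x + v * I) ^ 2)‖ = Real.exp (ε * (x ^ 2 - v ^ 2)) := by
    intro ε x v
    rw [norm_exp]
    congr 1
    simp [sq]
  have hC : 0 ≤ C := (norm_nonneg _).trans (hG σ₁ left_mem_uIcc 0)
  have hint : ∀ σ : ℝ, Integrable (fun v : ℝ => G (σ + v * I)) → ∀ ε : ℝ, 0 < ε →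
      Integrable fun v : ℝ => cexp (ε * (σ + v * I) ^ 2) * G (σ + v * I) := by
    intro σ h ε hε
    refine h.bdd_mul (c := Real.exp (ε * σ ^ 2)) (by fun_prop) (.of_forall fun v => ?_)
    rw [hnorm]
    gcongr
    nlinarith [sq_nonneg v]
  have heq : ∀ ε : ℝ, 0 < ε → ∫ v : ℝ, cexp (ε * (σ₁ + v * I) ^ 2) * G (σ₁ + v * I) =
      ∫ v : ℝ, cexp (ε * (σ₂ + v * I) ^ 2) * G (σ₂ + v * I) := by
    intro ε hε
    refine integral_vertical_eq_of_decay (H := fun s => cexp (ε * s ^ 2) * G s)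
      (by fun_prop) (hint _ h₁ ε hε) (hint _ h₂ ε hε)
      (B := fun w => Real.exp (ε * ((|σ₁| + |σ₂|) ^ 2 - w)) * C) ?_ ?_
    · intro x hx v
      have hx' : |x| ≤ |σ₁| + |σ₂| := by
        rcases mem_uIcc.1 hx with ⟨h, h'⟩ | ⟨h, h'⟩ <;> rw [abs_le] <;> constructor <;>
          linarith [neg_abs_le σ₁, neg_abs_le σ₂, le_abs_self σ₁, le_abs_self σ₂, abs_nonneg σ₁,
            abs_nonneg σ₂]
      have hsq : x ^ 2 ≤ (|σ₁| + |σ₂|) ^ 2 := by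
        rw [← sq_abs x]
        gcongr
      rw [norm_mul, hnorm]
      gcongr
      exact hG x hx v
    · have : Tendsto (fun w : ℝ => ε * ((|σ₁| + |σ₂|) ^ 2 - w)) atTop atBot :=
        (tendsto_const_nhds.add_atBot tendsto_neg_atTop_atBot).const_mul_atBot hε
      simpa using (Real.tendsto_exp_atBot.comp this).mul_const C
  have hlim : ∀ σ : ℝ, Integrable (fun v : ℝ => G (σ + v * I)) →
      Tendsto (fun ε : ℝ => ∫ v : ℝ, cexp (ε * (σ + v * I) ^ 2) * G (σ + v * I)) (𝓝[>] 0)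
        (𝓝 (∫ v : ℝ, G (σ + v * I))) := by
    intro σ h
    refine tendsto_integral_filter_of_dominated_convergence
      (fun v => Real.exp (σ ^ 2) * ‖G (σ + v * I)‖) ?_ ?_ (h.norm.const_mul _) (.of_forall ?_)
    · filter_upwards [self_mem_nhdsWithin] with ε hε using (hint σ h ε hε).aestronglyMeasurable
    · filter_upwards [Ioo_mem_nhdsGT one_pos] with ε hε
      refine .of_forall fun v => ?_
      rw [norm_mul, hnorm]
      gcongr
      nlinarith [sq_nonneg v, sq_nonneg σ, hε.1, hε.2, mul_nonneg hε.1.le (sq_nonneg v)]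
    · intro v
      have : Continuous fun ε : ℝ => cexp (ε * (σ + v * I) ^ 2) * G (σ + v * I) := by fun_prop
      simpa using (this.tendsto 0).mono_left nhdsWithin_le_nhds
  refine tendsto_nhds_unique (hlim σ₁ h₁) ((hlim σ₂ h₂).congr' ?_)
  filter_upwards [self_mem_nhdsWithin] with ε hε using (heq ε hε).symm

theorem integrable_Gamma_mul_Gamma_vertical {ν : ℂ} (hν : ν.re = 0) {σ : ℝ} (hσ : 2 ≤ σ) :
    Integrable fun v : ℝ => Gamma ((σ + v * I + ν) / 2) * Gamma ((σ + v * I - ν) / 2) := by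
  have e : ν = ν.im * I := by
    apply Complex.ext <;> simp [hν]
  have hc : 1 ≤ σ / 2 := by linarith
  have hp : ∀ v : ℝ, (σ + v * I + ν) / 2 = (σ / 2 : ℝ) + ((1 / 2) * v + ν.im / 2 : ℝ) * I := by
    intro v
    conv_lhs => rw [e]
    push_cast
    ring
  have hm : ∀ v : ℝ, (σ + v * I - ν) / 2 = (σ / 2 : ℝ) + ((1 / 2) * v - ν.im / 2 : ℝ) * I := by
    intro v
    conv_lhs => rw [e]
    push_cast
    ring
  have h1 : Integrable fun v : ℝ => Gamma ((σ + v * I - ν) / 2) := by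
    have := ((integrable_Gamma_vertical hc).comp_sub_right (ν.im / 2)).comp_mul_left'
      (show (1 / 2 : ℝ) ≠ 0 by norm_num)
    simpa only [hm] using this
  refine h1.bdd_mul (c := Real.Gamma (σ / 2)) ?_ (.of_forall fun v => ?_)
  · simp only [hp]
    exact ((continuous_Gamma_vertical (σ := σ / 2) (by linarith)).comp
      (show Continuous fun v : ℝ => (1 / 2) * v + ν.im / 2 by fun_prop)).aestronglyMeasurable
  · have hre : ((σ + v * I + ν) / 2).re = σ / 2 := by simp [hν]
    simpa only [hre] using norm_Gamma_le_Gamma_re (s := (σ + v * I + ν) / 2) (by rw [hre]; linarith)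

theorem norm_ofReal_cpow_neg_vertical {x : ℝ} (hx : 0 < x) (σ v : ℝ) :
    ‖(x : ℂ) ^ (-(σ + v * I))‖ = x ^ (-σ) := by
  rw [norm_cpow_eq_rpow_re_of_pos hx]
  simp

theorem summable_norm_mul_rpow_neg_of_le {a : ℕ+ → ℂ} {σ₀ σ : ℝ}
    (ha : Summable fun n : ℕ+ => ‖a n‖ * (n : ℝ) ^ (-σ₀)) (h : σ₀ ≤ σ) :
    Summable fun n : ℕ+ => ‖a n‖ * (n : ℝ) ^ (-σ) := by
  refine ha.of_nonneg_of_le (fun n => by positivity) fun n => ?_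
  have : (1 : ℝ) ≤ n := by exact_mod_cast n.pos
  gcongr

theorem integrable_completed_vertical {ν : ℂ} (hν : ν.re = 0) {A : ℝ} (hA : 0 < A) {a : ℕ+ → ℂ}
    {σ : ℝ} (hσ : 2 ≤ σ) (ha : Summable fun n : ℕ+ => ‖a n‖ * (n : ℝ) ^ (-σ)) {Λ : ℂ → ℂ}
    (hΛ : ∀ v : ℝ, Λ (σ + v * I) =
      (π : ℂ) ^ (-(σ + v * I)) * (A : ℂ) ^ ((σ + v * I) / 2) * Gamma ((σ + v * I + ν) / 2) *
        Gamma ((σ + v * I - ν) / 2) * ∑' n : ℕ+, a n * (n : ℂ) ^ (-(σ + v * I)))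
    (hc : Continuous Λ) : Integrable fun v : ℝ => Λ (σ + v * I) := by
  refine ((integrable_Gamma_mul_Gamma_vertical hν hσ).norm.const_mul
    (π ^ (-σ) * A ^ (σ / 2) * ∑' n : ℕ+, ‖a n‖ * (n : ℝ) ^ (-σ))).mono'
    (by fun_prop) (.of_forall fun v => ?_)
  have hL : ‖∑' n : ℕ+, a n * (n : ℂ) ^ (-(σ + v * I))‖ ≤ ∑' n : ℕ+, ‖a n‖ * (n : ℝ) ^ (-σ) := by
    refine tsum_of_norm_bounded ha.hasSum fun n => ?_
    rw [norm_mul, ← ofReal_natCast, norm_ofReal_cpow_neg_vertical (by exact_mod_cast n.pos)]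
  rw [hΛ, norm_mul, norm_mul, norm_mul, norm_mul, norm_ofReal_cpow_neg_vertical Real.pi_pos,
    norm_cpow_eq_rpow_re_of_pos hA, norm_mul,
    show ((σ + v * I) / 2).re = σ / 2 by simp]
  calc _ ≤ π ^ (-σ) * A ^ (σ / 2) * ‖Gamma ((σ + v * I + ν) / 2)‖ *
        ‖Gamma ((σ + v * I - ν) / 2)‖ * ∑' n : ℕ+, ‖a n‖ * (n : ℝ) ^ (-σ) := by gcongr
    _ = _ := by ring

theorem tsum_mul_KBessel_eq_integral {ν : ℂ} (hν : ν.re = 0) {A : ℝ} (hA : 0 < A) {a : ℕ+ → ℂ}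
    {σ : ℝ} (hσ : 2 ≤ σ) (ha : Summable fun n : ℕ+ => ‖a n‖ * (n : ℝ) ^ (-σ)) {Λ : ℂ → ℂ}
    (hΛ : ∀ v : ℝ, Λ (σ + v * I) =
      (π : ℂ) ^ (-(σ + v * I)) * (A : ℂ) ^ ((σ + v * I) / 2) * Gamma ((σ + v * I + ν) / 2) *
        Gamma ((σ + v * I - ν) / 2) * ∑' n : ℕ+, a n * (n : ℂ) ^ (-(σ + v * I)))
    {y : ℝ} (hy : 0 < y) :
    ∑' n : ℕ+, a n * KBessel ν (2 * π * n * y) =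
      1 / (8 * π) * ∫ v : ℝ, ((√A * y : ℝ) : ℂ) ^ (-(σ + v * I)) * Λ (σ + v * I) := by
  set g : ℝ → ℂ := fun v => Gamma ((σ + v * I + ν) / 2) * Gamma ((σ + v * I - ν) / 2) with hg
  have hgi : Integrable g := integrable_Gamma_mul_Gamma_vertical hν hσ
  set F : ℕ+ → ℝ → ℂ := fun n v => a n * (((π * n * y : ℝ) : ℂ) ^ (-(σ + v * I)) * g v) with hF
  have hn : ∀ n : ℕ+, (0 : ℝ) < n := fun n => by exact_mod_cast n.pos
  have hpos : ∀ n : ℕ+, 0 < π * n * y := fun n => mul_pos (mul_pos Real.pi_pos (hn n)) hy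
  have hFi : ∀ n, Integrable (F n) := by
    intro n
    have hne : ((π * n * y : ℝ) : ℂ) ≠ 0 := ofReal_ne_zero.2 (hpos n).ne'
    refine (hgi.bdd_mul (c := (π * n * y) ^ (-σ)) ?_ (.of_forall fun v => ?_)).const_mul _
    · refine Continuous.aestronglyMeasurable ?_
      exact (by fun_prop : Continuous fun v : ℝ => (-(σ + v * I) : ℂ)).const_cpow (.inl hne)
    · exact (norm_ofReal_cpow_neg_vertical (hpos n) σ v).le
  have hFn : ∀ n, ∫ v, ‖F n v‖ = ‖a n‖ * (n : ℝ) ^ (-σ) * ((π * y) ^ (-σ) * ∫ v, ‖g v‖) := by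
    intro n
    simp only [hF, norm_mul (a n), norm_mul _ (g _), norm_ofReal_cpow_neg_vertical (hpos n)]
    rw [integral_const_mul, integral_const_mul, show π * n * y = n * (π * y) by ring,
      Real.mul_rpow (hn n).le (by positivity)]
    ring
  have hsum := hasSum_integral_of_summable_integral_norm hFi (by
    simp only [hFn]
    exact ha.mul_right _)
  have hterm : ∀ n : ℕ+, a n * KBessel ν (2 * π * n * y) = 1 / (8 * π) * ∫ v, F n v := by
    intro n
    rw [show 2 * π * n * y = 2 * (π * n * y) by ring, KBessel_two_mul hν hσ (hpos n)]
    simp only [hF]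
    rw [integral_const_mul]
    ring
  simp only [hterm]
  rw [tsum_mul_left, hsum.tsum_eq]
  congr 2 with v
  have hpt : ∀ n : ℕ+, F n v = ((π * y : ℝ) : ℂ) ^ (-(σ + v * I)) * g v *
      (a n * (n : ℂ) ^ (-(σ + v * I))) := by
    intro n
    simp only [hF]
    rw [show π * n * y = (π * y) * n by ring, ofReal_mul (π * y),
      mul_cpow_ofReal_nonneg (by positivity) (hn n).le, ofReal_natCast]
    ring
  have hsqrt : (A : ℂ) ^ ((σ + v * I) / 2) = (√A : ℂ) ^ (σ + v * I) := by
    conv_lhs => rw [← Real.sq_sqrt hA.le, sq, ofReal_mul,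
      mul_cpow_ofReal_nonneg (Real.sqrt_nonneg A) (Real.sqrt_nonneg A),
      ← cpow_add _ _ (ofReal_ne_zero.2 (Real.sqrt_pos.2 hA).ne'), add_halves]
  have hA0 : (√A : ℂ) ^ (σ + v * I) ≠ 0 := by
    rw [Ne, cpow_eq_zero_iff]
    exact fun h => (Real.sqrt_pos.2 hA).ne' (ofReal_eq_zero.1 h.1)
  simp only [hpt]
  rw [tsum_mul_left, hΛ, hsqrt, ofReal_mul, mul_cpow_ofReal_nonneg Real.pi_pos.le hy.le,
    ofReal_mul, mul_cpow_ofReal_nonneg (Real.sqrt_nonneg A) hy.le, cpow_neg (√A : ℂ), hg]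
  field_simp

/-- Mellin-inversion mechanism: if the completed Dirichlet series
`Λ_a(s) = π^{−s}A^{s/2}Γ((s+ν)/2)Γ((s−ν)/2)Σ a(n)n^{−s}` and `Λ_b` extend to entire
functions, bounded on all vertical strips, satisfying `Λ_a(s) = T·Λ_b(1−s)`, then the
associated Bessel expansions satisfy `f(y) = T·g(1/(Ay))` for all `y > 0`. -/
theorem statement_14 (ν : ℂ) (hν : ν.re = 0) (A : ℝ) (hA : 0 < A) (T : ℂ)
    (a b : ℕ+ → ℂ) (σ₀ : ℝ)
    (ha : Summable fun n : ℕ+ => ‖a n‖ * (n : ℝ) ^ (-σ₀))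
    (hb : Summable fun n : ℕ+ => ‖b n‖ * (n : ℝ) ^ (-σ₀))
    (Λa Λb : ℂ → ℂ)
    (hΛa : ∀ s : ℂ, σ₀ < s.re → Λa s =
      (π : ℂ) ^ (-s) * (A : ℂ) ^ (s / 2) * Complex.Gamma ((s + ν) / 2) *
        Complex.Gamma ((s - ν) / 2) * ∑' n : ℕ+, a n * (n : ℂ) ^ (-s))
    (hΛb : ∀ s : ℂ, σ₀ < s.re → Λb s =
      (π : ℂ) ^ (-s) * (A : ℂ) ^ (s / 2) * Complex.Gamma ((s + ν) / 2) *
        Complex.Gamma ((s - ν) / 2) * ∑' n : ℕ+, b n * (n : ℂ) ^ (-s))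
    (hents : Differentiable ℂ Λa ∧ Differentiable ℂ Λb)
    (hbd_a : ∀ σ₁ σ₂ : ℝ, ∃ C : ℝ, ∀ s : ℂ, σ₁ ≤ s.re → s.re ≤ σ₂ → ‖Λa s‖ ≤ C)
    (hbd_b : ∀ σ₁ σ₂ : ℝ, ∃ C : ℝ, ∀ s : ℂ, σ₁ ≤ s.re → s.re ≤ σ₂ → ‖Λb s‖ ≤ C)
    (hfe : ∀ s : ℂ, Λa s = T * Λb (1 - s)) :
    ∀ y : ℝ, 0 < y →
      (∑' n : ℕ+, a n * (Real.sqrt y : ℂ) * KBessel ν (2 * π * n * y)) =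
        T * ∑' n : ℕ+, b n * (Real.sqrt (1 / (A * y)) : ℂ) *
          KBessel ν (2 * π * n * (1 / (A * y))) := by
  intro y hy
  obtain ⟨σ, hσ2, hσ0⟩ : ∃ σ : ℝ, 2 ≤ σ ∧ σ₀ < σ :=
    ⟨max 2 (σ₀ + 1), le_max_left _ _, (lt_add_one σ₀).trans_le (le_max_right _ _)⟩
  have hre : ∀ x v : ℝ, (x + v * I : ℂ).re = x := fun x v => by simp
  have ha' := summable_norm_mul_rpow_neg_of_le ha hσ0.le
  have hb' := summable_norm_mul_rpow_neg_of_le hb hσ0.le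
  have hΛa' := fun v : ℝ => hΛa (σ + v * I) (by rwa [hre])
  have hΛb' := fun v : ℝ => hΛb (σ + v * I) (by rwa [hre])
  have hia := integrable_completed_vertical hν hA hσ2 ha' hΛa' hents.1.continuous
  have hib := integrable_completed_vertical hν hA hσ2 hb' hΛb' hents.2.continuous
  set B : ℝ := √A * y with hB
  have hBpos : 0 < B := mul_pos (Real.sqrt_pos.2 hA) hy
  have hB0 : (B : ℂ) ≠ 0 := ofReal_ne_zero.2 hBpos.ne'
  set y' : ℝ := 1 / (A * y) with hy'
  have hy'pos : 0 < y' := by positivity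
  have hBy' : √A * y' = B⁻¹ := by
    rw [hB, hy']
    field_simp
    exact Real.sq_sqrt hA.le
  set G : ℂ → ℂ := fun s => (B : ℂ) ^ (-s) * Λa s with hG
  have hGd : Differentiable ℂ G := fun s =>
    (differentiableAt_id.neg.const_cpow (.inl hB0)).mul (hents.1 s)
  have hG₂ : Integrable fun v : ℝ => G (σ + v * I) := by
    refine hia.bdd_mul (c := B ^ (-σ)) ?_
      (.of_forall fun v => (norm_ofReal_cpow_neg_vertical hBpos σ v).le)
    exact ((by fun_prop : Continuous fun v : ℝ => (-(σ + v * I) : ℂ)).const_cpow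
      (.inl hB0)).aestronglyMeasurable
  set H : ℝ → ℂ := fun v => ((√A * y' : ℝ) : ℂ) ^ (-(σ + v * I)) * Λb (σ + v * I) with hH
  have hHi : Integrable H := by
    have hpos : 0 < √A * y' := mul_pos (Real.sqrt_pos.2 hA) hy'pos
    refine hib.bdd_mul (c := (√A * y') ^ (-σ)) ?_
      (.of_forall fun v => (norm_ofReal_cpow_neg_vertical hpos σ v).le)
    exact ((by fun_prop : Continuous fun v : ℝ => (-(σ + v * I) : ℂ)).const_cpow
      (.inl (ofReal_ne_zero.2 hpos.ne'))).aestronglyMeasurable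
  have hGH : ∀ v : ℝ, G ((1 - σ : ℝ) + v * I) = T * (B : ℂ)⁻¹ * H (-v) := by
    intro v
    simp only [hG, hH]
    have e1 : (1 - ((1 - σ : ℝ) + v * I) : ℂ) = σ + (-v : ℝ) * I := by
      push_cast
      ring
    have e2 : (-((1 - σ : ℝ) + v * I) : ℂ) = -1 + (σ + (-v : ℝ) * I) := by
      push_cast
      ring
    rw [hfe, e1, e2, hBy', cpow_add _ _ hB0, cpow_neg_one, ofReal_inv,
      inv_cpow _ _ (by rw [arg_ofReal_of_nonneg hBpos.le]; exact Real.pi_pos.ne), cpow_neg,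
      inv_inv]
    ring
  have hG₁ : Integrable fun v : ℝ => G ((1 - σ : ℝ) + v * I) := by
    simpa only [hGH] using hHi.comp_neg.const_mul (T * (B : ℂ)⁻¹)
  obtain ⟨C, hC⟩ := hbd_a (1 - σ) σ
  have hshift := integral_vertical_eq_of_bounded hGd (σ₁ := 1 - σ) (σ₂ := σ)
    (C := (B ^ (-σ) + B ^ (-(1 - σ))) * C) hG₁ hG₂ (by
      intro x hx v
      rw [uIcc_of_le (by linarith)] at hx
      have hCv := hC (x + v * I) (by rw [hre]; exact hx.1) (by rw [hre]; exact hx.2)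
      have hBx : B ^ (-x) ≤ B ^ (-σ) + B ^ (-(1 - σ)) := by
        have p1 := Real.rpow_nonneg hBpos.le (-σ)
        have p2 := Real.rpow_nonneg hBpos.le (-(1 - σ))
        rcases le_total 1 B with h | h
        · linarith [Real.rpow_le_rpow_of_exponent_le h (neg_le_neg hx.1)]
        · linarith [Real.rpow_le_rpow_of_exponent_ge hBpos h (neg_le_neg hx.2)]
      rw [hG, norm_mul, norm_ofReal_cpow_neg_vertical hBpos]
      gcongr)
  simp only [hGH] at hshift
  rw [integral_const_mul, integral_neg_eq_self H] at hshift
  have hfa := tsum_mul_KBessel_eq_integral hν hA hσ2 ha' hΛa' hy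
  have hfb := tsum_mul_KBessel_eq_integral hν hA hσ2 hb' hΛb' hy'pos
  have hs : (√y : ℂ) * (B : ℂ)⁻¹ = (√y' : ℂ) := by
    rw [← ofReal_inv, ← ofReal_mul]
    congr 1
    rw [hB, hy', one_div, Real.sqrt_inv, Real.sqrt_mul hA.le]
    have := Real.sq_sqrt hy.le
    have := Real.sqrt_pos.2 hy
    have := Real.sqrt_pos.2 hA
    field_simp
    assumption
  simp only [mul_right_comm _ (Complex.ofReal (√_)), tsum_mul_right]
  rw [hfa, hfb, ← hs, ← hshift]
  ring
end

section
/- Let ν ∈ ℂ and let s ∈ ℂ with Re(s) > |Re(ν)|. Then ∫₀^∞ K_ν(y)·y^{s−1} dy = 2^{s−2}·Γ((s−ν)/2)·Γ((s+ν)/2), where K_ν(y) = (1/2)∫₀^∞ e^{−y(t+t⁻¹)/2} t^ν dt/t, the integral converging absolutely. -/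
open scoped Real

open MeasureTheory Set

/-- The Mellin transform of a Gaussian. -/
lemma integral_cpow_mul_exp_neg_mul_sq {w : ℂ} (hw : 0 < w.re) {r : ℝ} (hr : 0 < r) :
    ∫ y in Ioi (0 : ℝ), (y : ℂ) ^ (w - 1) * Complex.exp (-(r * (y : ℂ) ^ 2)) =
      1 / 2 * ((1 / r : ℂ) ^ (w / 2) * Complex.Gamma (w / 2)) := by
  have h := mellin_comp_rpow (fun u : ℝ => Complex.exp (-(r * (u : ℂ)))) w 2
  have hw2 : 0 < (w / 2).re := by
    rw [Complex.div_ofNat_re]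
    positivity
  simp only [mellin, smul_eq_mul, Complex.ofReal_ofNat] at h
  rw [Complex.integral_cpow_mul_exp_neg_mul_Ioi hw2 hr] at h
  simpa using h

/-- The integrand of the double integral that evaluates the Mellin transform of `KBessel ν`,
obtained from the definition by the substitution `t = 2 x / y`. -/
noncomputable def kBesselKernel (ν s : ℂ) (y x : ℝ) : ℂ :=
  (2 : ℂ) ^ (ν - 1) * (Complex.exp (-(x : ℂ)) * (x : ℂ) ^ (ν - 1)) *
    ((y : ℂ) ^ (s - ν - 1) * Complex.exp (-(((1 / (4 * x) : ℝ) : ℂ) * (y : ℂ) ^ 2)))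

lemma KBessel_mul_cpow_eq_integral_kBesselKernel (ν s : ℂ) {y : ℝ} (hy : 0 < y) :
    KBessel ν y * (y : ℂ) ^ (s - 1) = ∫ x in Ioi (0 : ℝ), kBesselKernel ν s y x := by
  have hy0 : (y : ℂ) ≠ 0 := by exact_mod_cast hy.ne'
  have hsub := integral_comp_mul_left_Ioi (kBesselKernel ν s y) 0 (half_pos hy)
  rw [mul_zero, eq_inv_smul_iff₀ (half_pos hy).ne'] at hsub
  rw [← hsub, KBessel, ← integral_const_mul, ← integral_mul_const, ← integral_smul]
  refine setIntegral_congr_fun measurableSet_Ioi fun t (ht : 0 < t) => ?_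
  have ht0 : (t : ℂ) ≠ 0 := by exact_mod_cast ht.ne'
  have hexp : Complex.exp (-(y : ℂ) * ((t : ℂ) + (t : ℂ)⁻¹) / 2) =
      Complex.exp (-((y / 2 * t : ℝ) : ℂ)) *
        Complex.exp (-(((1 / (4 * (y / 2 * t)) : ℝ) : ℂ) * (y : ℂ) ^ 2)) := by
    rw [← Complex.exp_add]
    congr 1
    push_cast
    field_simp
    ring
  have hpow : ((y / 2 * t : ℝ) : ℂ) ^ (ν - 1) =
      (y : ℂ) ^ (ν - 1) / 2 ^ (ν - 1) * ((t : ℂ) ^ ν / t) := by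
    rw [Complex.ofReal_mul, Complex.mul_cpow_ofReal_nonneg (half_pos hy).le ht.le,
      Complex.ofReal_div, Complex.div_cpow_ofReal_nonneg hy.le zero_le_two,
      Complex.cpow_sub _ _ ht0, Complex.cpow_one, Complex.ofReal_ofNat]
  have hy' : (y : ℂ) ^ (s - 1) = y * (y : ℂ) ^ (ν - 1) * (y : ℂ) ^ (s - ν - 1) := by
    rw [show s - 1 = 1 + (ν - 1) + (s - ν - 1) by ring, Complex.cpow_add _ _ hy0,
      Complex.cpow_add _ _ hy0, Complex.cpow_one]
  have h2 : (2 : ℂ) ^ (ν - 1) ≠ 0 := by simp [Complex.cpow_eq_zero_iff]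
  simp only [kBesselKernel, Complex.real_smul]
  rw [hexp, hpow, hy']
  push_cast
  field_simp

lemma norm_kBesselKernel (ν s : ℂ) {y x : ℝ} (hy : 0 < y) (hx : 0 < x) :
    ‖kBesselKernel ν s y x‖ = 2 ^ (ν.re - 1) * (Real.exp (-x) * x ^ (ν.re - 1)) *
      (y ^ (s.re - ν.re - 1) * Real.exp (-(1 / (4 * x)) * y ^ (2 : ℝ))) := by
  have h2 : ‖(2 : ℂ) ^ (ν - 1)‖ = 2 ^ (ν.re - 1) := by
    simpa using Complex.norm_cpow_eq_rpow_re_of_pos two_pos (ν - 1)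
  rw [kBesselKernel, norm_mul, norm_mul, norm_mul, norm_mul, h2,
    Complex.norm_cpow_eq_rpow_re_of_pos hx, Complex.norm_cpow_eq_rpow_re_of_pos hy,
    Complex.norm_exp, Complex.norm_exp, Real.rpow_two]
  norm_cast
  simp

lemma integrable_kBesselKernel {ν s : ℂ} (hs : |ν.re| < s.re) :
    Integrable (Function.uncurry (kBesselKernel ν s))
      ((volume.restrict (Ioi (0 : ℝ))).prod (volume.restrict (Ioi (0 : ℝ)))) := by
  obtain ⟨hs₁, hs₂⟩ := abs_lt.mp hs
  have hmeas : Measurable (Function.uncurry (kBesselKernel ν s)) := by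
    unfold Function.uncurry kBesselKernel
    fun_prop
  rw [integrable_prod_iff' hmeas.aestronglyMeasurable]
  constructor
  · filter_upwards [ae_restrict_mem measurableSet_Ioi] with x (hx : 0 < x)
    refine (integrable_norm_iff (hmeas.comp measurable_prodMk_right).aestronglyMeasurable).mp ?_
    refine IntegrableOn.congr_fun ((integrableOn_rpow_mul_exp_neg_mul_rpow
      (s := s.re - ν.re - 1) (b := 1 / (4 * x)) (by linarith) two_pos (by positivity)).const_mul
      (2 ^ (ν.re - 1) * (Real.exp (-x) * x ^ (ν.re - 1)))) (fun y hy => ?_) measurableSet_Ioi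
    exact (norm_kBesselKernel ν s hy hx).symm
  · refine IntegrableOn.congr_fun ((Real.GammaIntegral_convergent
      (s := (s.re + ν.re) / 2) (by linarith)).const_mul
      (2 ^ (ν.re - 1) * 4 ^ ((s.re - ν.re) / 2) * (1 / 2) * Real.Gamma ((s.re - ν.re) / 2)))
      (fun x (hx : 0 < x) => ?_) measurableSet_Ioi
    simp only [Function.uncurry]
    rw [setIntegral_congr_fun measurableSet_Ioi fun y hy => norm_kBesselKernel ν s hy hx,
      integral_const_mul, integral_rpow_mul_exp_neg_mul_rpow two_pos (by linarith)
        (by positivity), sub_add_cancel, one_div (4 * x), neg_div,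
      Real.rpow_neg (by positivity), Real.inv_rpow (by positivity), inv_inv,
      Real.mul_rpow (by norm_num) hx.le,
      show (s.re + ν.re) / 2 - 1 = (ν.re - 1) + (s.re - ν.re) / 2 by ring, Real.rpow_add hx]
    ring

lemma integral_kBesselKernel {ν s : ℂ} (hs : ν.re < s.re) {x : ℝ} (hx : 0 < x) :
    ∫ y in Ioi (0 : ℝ), kBesselKernel ν s y x =
      2 ^ (s - 2) * Complex.Gamma ((s - ν) / 2) *
        (Complex.exp (-(x : ℂ)) * (x : ℂ) ^ ((s + ν) / 2 - 1)) := by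
  have hx0 : (x : ℂ) ≠ 0 := by exact_mod_cast hx.ne'
  have h4 : (4 : ℂ) ^ ((s - ν) / 2) = 2 ^ (s - ν) := by
    rw [show (4 : ℂ) = ((2 : ℝ) : ℂ) * ((2 : ℝ) : ℂ) by norm_num,
      Complex.mul_cpow_ofReal_nonneg zero_le_two zero_le_two, Complex.ofReal_ofNat,
      ← Complex.cpow_add _ _ two_ne_zero, add_halves]
  have h2 : (2 : ℂ) ^ (s - 2) = 2 ^ (ν - 1) * (1 / 2) * 2 ^ (s - ν) := by
    rw [show s - 2 = (ν - 1) + (-1) + (s - ν) by ring, Complex.cpow_add _ _ two_ne_zero,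
      Complex.cpow_add _ _ two_ne_zero, Complex.cpow_neg_one, one_div]
  have hr : (1 / ((1 / (4 * x) : ℝ) : ℂ)) ^ ((s - ν) / 2) =
      2 ^ (s - ν) * (x : ℂ) ^ ((s - ν) / 2) := by
    rw [← h4, show (1 / ((1 / (4 * x) : ℝ) : ℂ)) = ((4 : ℝ) : ℂ) * x by push_cast; field_simp,
      Complex.mul_cpow_ofReal_nonneg (by norm_num) hx.le, Complex.ofReal_ofNat]
  simp only [kBesselKernel]
  rw [integral_const_mul, integral_cpow_mul_exp_neg_mul_sq (by simpa using hs) (by positivity),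
    hr, h2, show (s + ν) / 2 - 1 = (ν - 1) + (s - ν) / 2 by ring, Complex.cpow_add _ _ hx0]
  ring

/-- for `Re(s) > |Re(ν)|`, the Mellin transform of the K-Bessel function is
`∫₀^∞ K_ν(y) y^{s−1} dy = 2^{s−2} Γ((s−ν)/2) Γ((s+ν)/2)`, the integral converging
absolutely. -/
theorem statement_15 (ν s : ℂ) (hs : |ν.re| < s.re) :
    MeasureTheory.IntegrableOn (fun y : ℝ => KBessel ν y * (y : ℂ) ^ (s - 1))
      (Set.Ioi (0 : ℝ)) ∧
    (∫ y in Set.Ioi (0 : ℝ), KBessel ν y * (y : ℂ) ^ (s - 1)) =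
      (2 : ℂ) ^ (s - 2) * Complex.Gamma ((s - ν) / 2) * Complex.Gamma ((s + ν) / 2) := by
  have hint := integrable_kBesselKernel hs
  obtain ⟨hs₁, hs₂⟩ := abs_lt.mp hs
  have hK : EqOn (fun y : ℝ => KBessel ν y * (y : ℂ) ^ (s - 1))
      (fun y => ∫ x in Ioi (0 : ℝ), kBesselKernel ν s y x) (Ioi 0) :=
    fun y hy => KBessel_mul_cpow_eq_integral_kBesselKernel ν s hy
  have hre : 0 < ((s + ν) / 2).re := by
    rw [Complex.div_ofNat_re, Complex.add_re]
    linarith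
  constructor
  · exact IntegrableOn.congr_fun hint.integral_prod_left hK.symm measurableSet_Ioi
  · rw [setIntegral_congr_fun measurableSet_Ioi hK, integral_integral_swap hint,
      setIntegral_congr_fun measurableSet_Ioi fun x hx => integral_kBesselKernel hs₂ hx,
      integral_const_mul, Complex.Gamma_eq_integral hre, Complex.GammaIntegral]
    simp
end
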